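/- arXiv:1410.7834 — 3 statements merged into one kernel-verified Lean document; each statement's English description precedes it below -/
import Mathlib

section
/- Suppose $f\colon \{0,1\}^n \to \{0,1\}$ is $\epsilon$-close (in squared $L_2$ norm under the uniform measure) to an affine function $\ell(x) = c_0 + \sum_i c_i x_i$. Then $\sum_{i=1}^n \mathrm{dist}(2\hat{\ell}(\{i\}), \{0, \pm 1\})^2 = O(\epsilon)$, i.e., there is an absolute constant $C$ such that this sum is at most $C\epsilon$. -/
/-- Expectation over the uniform measure on the Boolean cube `{0,1}ⁿ`. -/
noncomputable def cubeExp (n : ℕ) (h : (Fin n → Bool) → ℝ) : ℝ :=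
  (∑ x : Fin n → Bool, h x) / 2 ^ n

/-- Fourier coefficient at `S` under the uniform measure. -/
noncomputable def cubeFourier (n : ℕ) (f : (Fin n → Bool) → ℝ) (S : Finset (Fin n)) : ℝ :=
  (∑ x : Fin n → Bool, f x * (-1 : ℝ) ^ (S.filter (fun i => x i = true)).card) / 2 ^ n

/-- Distance from a real number to the set `{0, 1, -1}`. -/
noncomputable def distZPM (x : ℝ) : ℝ := min |x| (min |x - 1| |x + 1|)

section CubeExpectation

variable {n : ℕ}

theorem cubeExp_add (g h : (Fin n → Bool) → ℝ) :
    cubeExp n (fun x => g x + h x) = cubeExp n g + cubeExp n h := by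
  simp only [cubeExp, Finset.sum_add_distrib, add_div]

theorem cubeExp_const_mul (a : ℝ) (g : (Fin n → Bool) → ℝ) :
    cubeExp n (fun x => a * g x) = a * cubeExp n g := by
  simp only [cubeExp, ← Finset.mul_sum, mul_div_assoc]

theorem cubeExp_const (a : ℝ) : cubeExp n (fun _ => a) = a := by
  simp [cubeExp]

theorem cubeExp_mono {g h : (Fin n → Bool) → ℝ} (hgh : ∀ x, g x ≤ h x) :
    cubeExp n g ≤ cubeExp n h := by
  unfold cubeExp
  gcongr with x
  exact hgh x

/-- Flip the coordinates in `I`. -/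
def cubeFlip (I : Finset (Fin n)) (x : Fin n → Bool) : Fin n → Bool :=
  fun i => if i ∈ I then !x i else x i

theorem cubeFlip_involutive (I : Finset (Fin n)) : Function.Involutive (cubeFlip I) := by
  intro x
  funext i
  by_cases h : i ∈ I <;> simp [cubeFlip, h]

theorem cubeExp_comp_cubeFlip (I : Finset (Fin n)) (g : (Fin n → Bool) → ℝ) :
    cubeExp n (fun x => g (cubeFlip I x)) = cubeExp n g := by
  exact congrArg (· / 2 ^ n) (Equiv.sum_comp (cubeFlip_involutive I).toPerm g)

/-- The sign `1` of `true` and `-1` of `false`. -/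
def boolSign (b : Bool) : ℝ := if b then 1 else -1

theorem boolSign_not (b : Bool) : boolSign (!b) = -boolSign b := by
  cases b <;> simp [boolSign]

theorem boolSign_sq (b : Bool) : boolSign b ^ 2 = 1 := by
  cases b <;> simp [boolSign]

/-- The Rademacher sum with coefficients `c` over the index set `I`. -/
noncomputable def rademacherSum (c : Fin n → ℝ) (I : Finset (Fin n)) (x : Fin n → Bool) : ℝ :=
  ∑ i ∈ I, c i * boolSign (x i)

theorem rademacherSum_cubeFlip_of_notMem (c : Fin n → ℝ) {I : Finset (Fin n)} {i : Fin n}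
    (hi : i ∉ I) (x : Fin n → Bool) :
    rademacherSum c I (cubeFlip {i} x) = rademacherSum c I x := by
  refine Finset.sum_congr rfl fun j hj => ?_
  have hji : j ≠ i := fun h => hi (h ▸ hj)
  simp [cubeFlip, hji]

theorem cubeExp_boolSign_mul_eq_zero (i : Fin n) {g : (Fin n → Bool) → ℝ}
    (hg : ∀ x, g (cubeFlip {i} x) = g x) :
    cubeExp n (fun x => boolSign (x i) * g x) = 0 := by
  have h := cubeExp_comp_cubeFlip {i} (fun x => boolSign (x i) * g x)
  have h' : (fun x : Fin n → Bool => boolSign (cubeFlip {i} x i) * g (cubeFlip {i} x)) =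
      fun x => (-1) * (boolSign (x i) * g x) := by
    funext x
    rw [hg]
    simp [cubeFlip, boolSign_not]
  rw [h', cubeExp_const_mul] at h
  linarith

theorem cubeExp_rademacherSum_sq (c : Fin n → ℝ) (I : Finset (Fin n)) :
    cubeExp n (fun x => rademacherSum c I x ^ 2) = ∑ i ∈ I, c i ^ 2 := by
  induction I using Finset.induction_on with
  | empty => simp [rademacherSum, cubeExp]
  | insert i I hi ih =>
    have hexp : (fun x => rademacherSum c (insert i I) x ^ 2) = fun x =>
        (rademacherSum c I x ^ 2 + c i ^ 2) +
          boolSign (x i) * (2 * c i * rademacherSum c I x) := by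
      funext x
      have hins : rademacherSum c (insert i I) x =
          c i * boolSign (x i) + rademacherSum c I x := Finset.sum_insert hi
      rw [hins]
      linear_combination c i ^ 2 * boolSign_sq (x i)
    rw [hexp, cubeExp_add, cubeExp_add, cubeExp_const, ih, cubeExp_boolSign_mul_eq_zero i,
      Finset.sum_insert hi]
    · ring
    · intro x
      rw [rademacherSum_cubeFlip_of_notMem c hi]

theorem cubeExp_rademacherSum_pow_four_le (c : Fin n → ℝ) (I : Finset (Fin n)) :
    cubeExp n (fun x => rademacherSum c I x ^ 4) ≤ 3 * (∑ i ∈ I, c i ^ 2) ^ 2 := by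
  induction I using Finset.induction_on with
  | empty => simp [rademacherSum, cubeExp]
  | insert i I hi ih =>
    have hexp : (fun x => rademacherSum c (insert i I) x ^ 4) = fun x =>
        (rademacherSum c I x ^ 4 + 6 * c i ^ 2 * rademacherSum c I x ^ 2 + c i ^ 4) +
          boolSign (x i) *
            (4 * c i * rademacherSum c I x ^ 3 + 4 * c i ^ 3 * rademacherSum c I x) := by
      funext x
      have hins : rademacherSum c (insert i I) x =
          c i * boolSign (x i) + rademacherSum c I x := Finset.sum_insert hi
      rw [hins]
      linear_combination (c i ^ 4 * (boolSign (x i) ^ 2 + 1) +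
        4 * c i ^ 3 * rademacherSum c I x * boolSign (x i) +
        6 * c i ^ 2 * rademacherSum c I x ^ 2) * boolSign_sq (x i)
    rw [hexp, cubeExp_add, cubeExp_add, cubeExp_add, cubeExp_const, cubeExp_const_mul,
      cubeExp_rademacherSum_sq, cubeExp_boolSign_mul_eq_zero i, Finset.sum_insert hi]
    · nlinarith [sq_nonneg (c i ^ 2)]
    · intro x
      rw [rademacherSum_cubeFlip_of_notMem c hi]

end CubeExpectation

section DistZPM

theorem distZPM_nonneg (y : ℝ) : 0 ≤ distZPM y := by
  unfold distZPM
  positivity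

theorem distZPM_neg (y : ℝ) : distZPM (-y) = distZPM y := by
  have h₁ : |-y - 1| = |y + 1| := by rw [← abs_neg]; ring_nf
  have h₂ : |-y + 1| = |y - 1| := by rw [← abs_neg]; ring_nf
  rw [distZPM, distZPM, abs_neg, h₁, h₂, min_comm |y + 1|]

theorem distZPM_sq_le {y k : ℝ} (hk : k = 0 ∨ k = 1 ∨ k = -1) :
    distZPM y ^ 2 ≤ (y - k) ^ 2 := by
  rw [← sq_abs (y - k)]
  refine pow_le_pow_left₀ (distZPM_nonneg y) ?_ 2
  rcases hk with rfl | rfl | rfl <;> simp [distZPM]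

theorem exists_distZPM_eq (y : ℝ) :
    ∃ k : ℝ, (k = 0 ∨ k = 1 ∨ k = -1) ∧ distZPM y = |y - k| := by
  unfold distZPM
  rcases min_choice |y| (min |y - 1| |y + 1|) with h | h
  · exact ⟨0, by simp, by simpa using h⟩
  · rcases min_choice |y - 1| |y + 1| with h' | h'
    · exact ⟨1, by simp, h.trans h'⟩
    · exact ⟨-1, by simp, by simpa using h.trans h'⟩

theorem sub_four_mul_pow_four_le_distZPM_sq (y : ℝ) : y ^ 2 - 4 * y ^ 4 ≤ distZPM y ^ 2 := by
  obtain ⟨k, hk, hd⟩ := exists_distZPM_eq y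
  rw [hd, sq_abs]
  rcases hk with rfl | rfl | rfl
  · nlinarith [sq_nonneg (y ^ 2)]
  · nlinarith [sq_nonneg (2 * y ^ 2 - 1 / 2), sq_nonneg (y - 1 / 2), sq_nonneg (y ^ 2 - 1 / 4)]
  · nlinarith [sq_nonneg (2 * y ^ 2 - 1 / 2), sq_nonneg (y + 1 / 2), sq_nonneg (y ^ 2 - 1 / 4)]

theorem sq_le_distZPM_sq (y : ℝ) : y ^ 2 ≤ 5 / 4 + 5 * distZPM y ^ 2 := by
  obtain ⟨k, hk, hd⟩ := exists_distZPM_eq y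
  rw [hd, sq_abs]
  rcases hk with rfl | rfl | rfl
  · nlinarith [sq_nonneg y]
  · nlinarith [sq_nonneg (4 * y - 5)]
  · nlinarith [sq_nonneg (4 * y + 5)]

theorem distZPM_eq_abs {y : ℝ} (hy : |y| ≤ 1 / 2) : distZPM y = |y| := by
  obtain ⟨h₁, h₂⟩ := abs_le.mp hy
  refine min_eq_left (le_min ?_ ?_)
  · exact hy.trans (by rw [le_abs]; right; linarith)
  · exact hy.trans (by rw [le_abs]; left; linarith)

theorem sq_ge_of_distZPM_sq_le {y : ℝ} (hy : 1 / 2 < |y|) (hd : distZPM y ^ 2 ≤ 1 / 100) :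
    81 / 100 ≤ y ^ 2 := by
  obtain ⟨k, hk, hk'⟩ := exists_distZPM_eq y
  have hd' : |y - k| ≤ 1 / 10 := by
    rw [hk'] at hd
    exact abs_le_of_sq_le_sq' (by rw [sq_abs] at hd; linarith) (by norm_num) |> abs_le.mpr
  obtain ⟨h₁, h₂⟩ := abs_le.mp hd'
  rcases hk with rfl | rfl | rfl
  · rw [sub_zero] at hd'
    linarith
  · nlinarith
  · nlinarith

end DistZPM

section NearBoolean

variable {n : ℕ}

theorem affine_sub_affine_cubeFlip (c₀ : ℝ) (c : Fin n → ℝ) (I : Finset (Fin n))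
    (x : Fin n → Bool) :
    (c₀ + ∑ i, (if x i then c i else 0)) - (c₀ + ∑ i, (if cubeFlip I x i then c i else 0)) =
      rademacherSum c I x := by
  rw [add_sub_add_left_eq_sub, ← Finset.sum_sub_distrib, rademacherSum,
    ← Finset.sum_subset (Finset.subset_univ I)]
  · refine Finset.sum_congr rfl fun i hi => ?_
    cases hx : x i <;> simp [cubeFlip, hi, hx, boolSign]
  · intro i _ hi
    simp [cubeFlip, hi]

theorem two_mul_cubeFourier_affine (c₀ : ℝ) (c : Fin n → ℝ) (i : Fin n) :
    2 * cubeFourier n (fun x => c₀ + ∑ j, (if x j then c j else 0)) {i} = -c i := by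
  set ℓ : (Fin n → Bool) → ℝ := fun x => c₀ + ∑ j, (if x j then c j else 0) with hℓ
  have hF : cubeFourier n ℓ {i} = cubeExp n (fun x => -(boolSign (x i)) * ℓ x) := by
    unfold cubeFourier cubeExp
    congr 1
    refine Finset.sum_congr rfl fun x _ => ?_
    cases hx : x i <;> simp [Finset.filter_singleton, hx, boolSign]
  have hflip := cubeExp_comp_cubeFlip {i} (fun x => -(boolSign (x i)) * ℓ x)
  have hsum : cubeExp n (fun x => -(boolSign (x i)) * ℓ x +
      -(boolSign (cubeFlip {i} x i)) * ℓ (cubeFlip {i} x)) = -c i := by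
    rw [← cubeExp_const (n := n) (-c i)]
    congr 1
    funext x
    have h := affine_sub_affine_cubeFlip c₀ c {i} x
    change ℓ x - ℓ (cubeFlip {i} x) = _ at h
    have hs : boolSign (cubeFlip {i} x i) = -boolSign (x i) := by
      simp [cubeFlip, boolSign_not]
    rw [rademacherSum, Finset.sum_singleton] at h
    rw [hs]
    linear_combination -boolSign (x i) * h - c i * boolSign_sq (x i)
  rw [cubeExp_add, hflip] at hsum
  rw [hF]
  linarith

/-- Differences of an affine function close to a Boolean function are close to `{0, 1, -1}`. -/
theorem cubeExp_distZPM_rademacherSum_sq_le {f : (Fin n → Bool) → ℝ} {c₀ : ℝ} {c : Fin n → ℝ}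
    {ε : ℝ} (hf : ∀ x, f x = 0 ∨ f x = 1)
    (hε : cubeExp n (fun x => (f x - (c₀ + ∑ i, (if x i then c i else 0))) ^ 2) ≤ ε)
    (I : Finset (Fin n)) :
    cubeExp n (fun x => distZPM (rademacherSum c I x) ^ 2) ≤ 4 * ε := by
  set g : (Fin n → Bool) → ℝ :=
    fun x => (f x - (c₀ + ∑ i, (if x i then c i else 0))) ^ 2 with hg
  calc cubeExp n (fun x => distZPM (rademacherSum c I x) ^ 2)
      ≤ cubeExp n (fun x => 2 * (g x + g (cubeFlip I x))) := by
        refine cubeExp_mono fun x => ?_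
        have hk : f x - f (cubeFlip I x) = 0 ∨ f x - f (cubeFlip I x) = 1 ∨
            f x - f (cubeFlip I x) = -1 := by
          rcases hf x with h | h <;> rcases hf (cubeFlip I x) with h' | h' <;> simp [h, h']
        refine (distZPM_sq_le hk).trans ?_
        rw [← affine_sub_affine_cubeFlip c₀ c I x]
        simp only [hg]
        set a := c₀ + ∑ i, (if x i then c i else 0)
        set b := c₀ + ∑ i, (if cubeFlip I x i then c i else 0)
        nlinarith [sq_nonneg ((f x - a) + (f (cubeFlip I x) - b))]
    _ ≤ 4 * ε := by
        rw [cubeExp_const_mul, cubeExp_add, cubeExp_comp_cubeFlip]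
        linarith

variable {c : Fin n → ℝ} {δ : ℝ}

theorem distZPM_coeff_sq_le
    (h : ∀ I, cubeExp n (fun x => distZPM (rademacherSum c I x) ^ 2) ≤ δ) (i : Fin n) :
    distZPM (c i) ^ 2 ≤ δ := by
  have hi : cubeExp n (fun x => distZPM (rademacherSum c {i} x) ^ 2) = distZPM (c i) ^ 2 := by
    rw [← cubeExp_const (n := n) (distZPM (c i) ^ 2)]
    congr 1
    funext x
    rw [rademacherSum, Finset.sum_singleton]
    cases x i <;> simp [boolSign, distZPM_neg]
  exact hi ▸ h {i}

theorem sum_coeff_sq_le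
    (h : ∀ I, cubeExp n (fun x => distZPM (rademacherSum c I x) ^ 2) ≤ δ)
    (I : Finset (Fin n)) : ∑ i ∈ I, c i ^ 2 ≤ 5 / 4 + 5 * δ := by
  have hle := cubeExp_mono fun x => sq_le_distZPM_sq (rademacherSum c I x)
  rw [cubeExp_rademacherSum_sq, cubeExp_add, cubeExp_const, cubeExp_const_mul] at hle
  linarith [h I]

/-- The squared coefficients in a set cannot have a sum strictly between `2 * δ` and `1 / 24`, so
adding small coefficients one at a time never takes the sum above `2 * δ`. -/
theorem sum_small_coeff_sq_le
    (h : ∀ I, cubeExp n (fun x => distZPM (rademacherSum c I x) ^ 2) ≤ δ)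
    (hδ : δ ≤ 1 / 100) (I : Finset (Fin n)) (hI : ∀ i ∈ I, |c i| ≤ 1 / 2) :
    ∑ i ∈ I, c i ^ 2 ≤ 2 * δ := by
  have hgap : ∀ J : Finset (Fin n), ∑ i ∈ J, c i ^ 2 ≤ 1 / 24 → ∑ i ∈ J, c i ^ 2 ≤ 2 * δ := by
    intro J hJ
    have hle := cubeExp_mono fun x => sub_four_mul_pow_four_le_distZPM_sq (rademacherSum c J x)
    simp only [sub_eq_add_neg, ← neg_mul] at hle
    rw [cubeExp_add, cubeExp_const_mul, cubeExp_rademacherSum_sq] at hle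
    have hnonneg : 0 ≤ ∑ i ∈ J, c i ^ 2 := Finset.sum_nonneg fun i _ => sq_nonneg _
    nlinarith [h J, cubeExp_rademacherSum_pow_four_le c J]
  induction I using Finset.induction_on with
  | empty => exact hgap ∅ (by norm_num)
  | insert i I hi ih =>
    refine hgap _ ?_
    rw [Finset.sum_insert hi]
    have hs := ih fun j hj => hI j (Finset.mem_insert_of_mem hj)
    have hci := distZPM_coeff_sq_le h i
    rw [distZPM_eq_abs (hI i (Finset.mem_insert_self i I)), sq_abs] at hci
    linarith

theorem sum_distZPM_coeff_sq_le
    (h : ∀ I, cubeExp n (fun x => distZPM (rademacherSum c I x) ^ 2) ≤ δ) :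
    ∑ i, distZPM (c i) ^ 2 ≤ 130 * δ := by
  have hsq : ∀ i, distZPM (c i) ^ 2 ≤ c i ^ 2 := fun i => by
    simpa using distZPM_sq_le (y := c i) (k := 0) (Or.inl rfl)
  rcases le_or_gt δ (1 / 100) with hδ | hδ
  · have hδ₀ : 0 ≤ δ := by
      refine le_trans ?_ (h ∅)
      rw [← cubeExp_const (n := n) 0]
      exact cubeExp_mono fun x => sq_nonneg _
    rw [← Finset.sum_filter_add_sum_filter_not Finset.univ (fun i => |c i| ≤ 1 / 2)]
    have hsmall : ∑ i with |c i| ≤ 1 / 2, distZPM (c i) ^ 2 ≤ 2 * δ :=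
      (Finset.sum_le_sum fun i _ => hsq i).trans
        (sum_small_coeff_sq_le h hδ _ fun i hi => (Finset.mem_filter.mp hi).2)
    have hcard : (Finset.univ.filter fun i => ¬|c i| ≤ 1 / 2).card ≤ 1 := by
      refine Finset.card_le_one.mpr fun i hi j hj => ?_
      by_contra hij
      have hi' := sq_ge_of_distZPM_sq_le (not_le.mp (Finset.mem_filter.mp hi).2)
        ((distZPM_coeff_sq_le h i).trans hδ)
      have hj' := sq_ge_of_distZPM_sq_le (not_le.mp (Finset.mem_filter.mp hj).2)
        ((distZPM_coeff_sq_le h j).trans hδ)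
      have hsum := sum_coeff_sq_le h {i, j}
      rw [Finset.sum_pair hij] at hsum
      linarith
    have hlarge : ∑ i with ¬|c i| ≤ 1 / 2, distZPM (c i) ^ 2 ≤ δ := by
      refine (Finset.sum_le_card_nsmul _ _ δ fun i _ => distZPM_coeff_sq_le h i).trans ?_
      rw [nsmul_eq_mul]
      exact mul_le_of_le_one_left hδ₀ (by exact_mod_cast hcard)
    linarith
  · linarith [Finset.sum_le_sum fun i (_ : i ∈ Finset.univ) => hsq i,
      sum_coeff_sq_le h Finset.univ]

end NearBoolean

/-- a consequence of the FKN theorem. If a Boolean `f` on the cube is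
`ε`-close to an affine `ℓ`, then `∑ᵢ dist(2ℓ̂({i}), {0,±1})² = O(ε)`. -/
theorem fkn_consequence :
    ∃ C > (0 : ℝ), ∀ (n : ℕ) (f : (Fin n → Bool) → ℝ) (c₀ : ℝ) (c : Fin n → ℝ) (ε : ℝ),
      (∀ x, f x = 0 ∨ f x = 1) →
      cubeExp n (fun x => (f x - (c₀ + ∑ i : Fin n, (if x i then c i else 0))) ^ 2) ≤ ε →
      ∑ i : Fin n,
          distZPM (2 * cubeFourier n
            (fun x => c₀ + ∑ j : Fin n, (if x j then c j else 0)) {i}) ^ 2 ≤ C * ε := by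
  refine ⟨520, by norm_num, fun n f c₀ c ε hf hε => ?_⟩
  simp only [two_mul_cubeFourier_affine, distZPM_neg]
  linarith [sum_distZPM_coeff_sq_le (cubeExp_distZPM_rademacherSum_sq_le hf hε)]
end

section
/- Suppose $2 \le k \le n-2$ and $f\colon \binom{[n]}{k} \to \{0,1\}$ is $\epsilon$-close (squared $L_2$, uniform measure) to an affine function $\sum_i c_i x_i$, with $p = \min(k/n, 1-k/n)$. Then there is an absolute constant $C$ such that either $f$ or $1-f$ is $C\epsilon$-close to $\max_{i\in S} x_i$ (if $k/n \le 1/2$) or to $\min_{i\in S} x_i$ (if $k/n \ge 1/2$) for some $S \subseteq [n]$ with $|S| \le \max(1, C\sqrt{\epsilon}/p)$. -/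
/-- The slice `[n] choose k`. -/
def theSlice (n k : ℕ) : Finset (Finset (Fin n)) := Finset.powersetCard k Finset.univ

/-- Expectation over the uniform measure on the slice. -/
noncomputable def sliceExp (n k : ℕ) (g : Finset (Fin n) → ℝ) : ℝ :=
  (∑ T ∈ theSlice n k, g T) / (n.choose k)

/-- `max_{i ∈ S} x_i` on the slice (with `max_∅ = 0`): `1` iff `S ∩ T ≠ ∅`. -/
def maxInd {n : ℕ} (S : Finset (Fin n)) (T : Finset (Fin n)) : ℝ :=
  if (S ∩ T).Nonempty then 1 else 0

/-- `min_{i ∈ S} x_i` on the slice (with `min_∅ = 1`): `1` iff `S ⊆ T`. -/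
def minInd {n : ℕ} (S : Finset (Fin n)) (T : Finset (Fin n)) : ℝ :=
  if S ⊆ T then 1 else 0

open Finset

/-! ### Expectations over the slice -/

lemma mem_theSlice {n k : ℕ} {T : Finset (Fin n)} : T ∈ theSlice n k ↔ T.card = k := by
  simp [theSlice, mem_powersetCard]

lemma sliceExp_mono {n k : ℕ} {g h : Finset (Fin n) → ℝ}
    (hgh : ∀ T ∈ theSlice n k, g T ≤ h T) : sliceExp n k g ≤ sliceExp n k h :=
  div_le_div_of_nonneg_right (sum_le_sum hgh) (Nat.cast_nonneg _)

lemma sliceExp_congr {n k : ℕ} {g h : Finset (Fin n) → ℝ}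
    (hgh : ∀ T ∈ theSlice n k, g T = h T) : sliceExp n k g = sliceExp n k h := by
  unfold sliceExp
  rw [sum_congr rfl hgh]

lemma sliceExp_add (n k : ℕ) (g h : Finset (Fin n) → ℝ) :
    sliceExp n k (fun T => g T + h T) = sliceExp n k g + sliceExp n k h := by
  simp only [sliceExp, sum_add_distrib, add_div]

lemma sliceExp_const_mul (n k : ℕ) (a : ℝ) (g : Finset (Fin n) → ℝ) :
    sliceExp n k (fun T => a * g T) = a * sliceExp n k g := by
  simp only [sliceExp, ← mul_sum, mul_div_assoc]

lemma sliceExp_const {n k : ℕ} (hk : k ≤ n) (a : ℝ) : sliceExp n k (fun _ => a) = a := by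
  have : (n.choose k : ℝ) ≠ 0 := by exact_mod_cast (Nat.choose_pos hk).ne'
  simp [sliceExp, theSlice, this]

lemma sliceExp_sum {ι : Type*} (n k : ℕ) (s : Finset ι) (g : ι → Finset (Fin n) → ℝ) :
    sliceExp n k (fun T => ∑ i ∈ s, g i T) = ∑ i ∈ s, sliceExp n k (g i) := by
  simp only [sliceExp, ← sum_div]
  rw [sum_comm]

lemma sliceExp_sq_sub_le {n k : ℕ} {f g h : Finset (Fin n) → ℝ} {a b : ℝ}
    (hfg : sliceExp n k (fun T => (f T - g T) ^ 2) ≤ a)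
    (hgh : sliceExp n k (fun T => (g T - h T) ^ 2) ≤ b) :
    sliceExp n k (fun T => (f T - h T) ^ 2) ≤ 2 * a + 2 * b := by
  calc sliceExp n k (fun T => (f T - h T) ^ 2)
      ≤ sliceExp n k (fun T => 2 * (f T - g T) ^ 2 + 2 * (g T - h T) ^ 2) :=
        sliceExp_mono fun T _ => by nlinarith [sq_nonneg (f T - 2 * g T + h T)]
    _ ≤ 2 * a + 2 * b := by
        rw [sliceExp_add, sliceExp_const_mul, sliceExp_const_mul]; linarith

/-! ### Averaging over permutations -/

lemma sliceExp_map_perm {n : ℕ} (k : ℕ) (π : Equiv.Perm (Fin n)) (g : Finset (Fin n) → ℝ) :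
    sliceExp n k (fun T => g (T.map π.toEmbedding)) = sliceExp n k g := by
  unfold sliceExp
  congr 1
  refine sum_equiv (Equiv.finsetCongr π) (fun T => ?_) (fun T _ => ?_)
  · simp [mem_theSlice]
  · simp

lemma exists_perm_map_eq {n : ℕ} {S T : Finset (Fin n)} (h : S.card = T.card) :
    ∃ π : Equiv.Perm (Fin n), S.map π.toEmbedding = T := by
  classical
  obtain ⟨e⟩ : Nonempty ({x // x ∈ S} ≃ {x // x ∈ T}) :=
    ⟨Finset.equivOfCardEq h⟩
  refine ⟨e.extendSubtype, ?_⟩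
  refine eq_of_subset_of_card_le (fun x hx => ?_) (by simp [h])
  obtain ⟨y, hy, rfl⟩ := mem_map.1 hx
  exact e.extendSubtype_mem y hy

lemma sum_perm_map_eq {n k : ℕ} (hk : k ≤ n) {S : Finset (Fin n)} (hS : S.card = k)
    (g : Finset (Fin n) → ℝ) :
    ∑ π : Equiv.Perm (Fin n), g (S.map π.toEmbedding) = n.factorial * sliceExp n k g := by
  have key : sliceExp n k (fun T => ∑ π : Equiv.Perm (Fin n), g (T.map π.toEmbedding))
      = ∑ π : Equiv.Perm (Fin n), g (S.map π.toEmbedding) := by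
    rw [← sliceExp_const hk (∑ π : Equiv.Perm (Fin n), g (S.map π.toEmbedding))]
    refine sliceExp_congr fun T hT => ?_
    obtain ⟨ρ, rfl⟩ := exists_perm_map_eq (hS.trans (mem_theSlice.1 hT).symm)
    rw [← Equiv.sum_comp (Equiv.mulRight ρ) fun π : Equiv.Perm (Fin n) => g (S.map π.toEmbedding)]
    refine sum_congr rfl fun π _ => ?_
    rw [map_map]
    rfl
  rw [← key, sliceExp_sum]
  simp [sliceExp_map_perm, Fintype.card_perm]

lemma exists_perm_apply_pair {n : ℕ} {a b a' b' : Fin n} (h : a ≠ b) (h' : a' ≠ b') :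
    ∃ π : Equiv.Perm (Fin n), π a = a' ∧ π b = b' := by
  refine ⟨Equiv.swap (Equiv.swap a a' b) b' * Equiv.swap a a', ?_, ?_⟩
  · have : a' ≠ Equiv.swap a a' b := fun e => h <| by
      have := congrArg (Equiv.swap a a') e
      simpa using this
    simp [Equiv.swap_apply_of_ne_of_ne this h']
  · simp

lemma sum_perm_pair {n : ℕ} {a b : Fin n} (hab : a ≠ b) (g : Fin n → Fin n → ℝ)
    (hg : ∀ i, g i i = 0) :
    (n * (n - 1) : ℝ) * ∑ π : Equiv.Perm (Fin n), g (π a) (π b)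
      = n.factorial * ∑ i, ∑ j, g i j := by
  have key : ∀ i j : Fin n, i ≠ j →
      ∑ π : Equiv.Perm (Fin n), g (π i) (π j) = ∑ π : Equiv.Perm (Fin n), g (π a) (π b) := by
    intro i j hij
    obtain ⟨ρ, rfl, rfl⟩ := exists_perm_apply_pair hab hij
    rw [← Equiv.sum_comp (Equiv.mulRight ρ) fun π : Equiv.Perm (Fin n) => g (π a) (π b)]
    rfl
  have h1 : ∑ i : Fin n, ∑ j : Fin n, ∑ π : Equiv.Perm (Fin n), g (π i) (π j)
      = (n * (n - 1) : ℝ) * ∑ π : Equiv.Perm (Fin n), g (π a) (π b) := by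
    set G := ∑ π : Equiv.Perm (Fin n), g (π a) (π b)
    have : ∀ i j : Fin n, ∑ π : Equiv.Perm (Fin n), g (π i) (π j)
        = G - if i = j then G else 0 := by
      intro i j
      by_cases hij : i = j
      · simp [hij, hg]
      · simp [hij, key i j hij]
    simp only [this, sum_sub_distrib, sum_ite_eq, mem_univ, if_true, sum_const, card_univ,
      Fintype.card_fin, nsmul_eq_mul]
    ring
  have h2 : ∑ i : Fin n, ∑ j : Fin n, ∑ π : Equiv.Perm (Fin n), g (π i) (π j)
      = ∑ π : Equiv.Perm (Fin n), ∑ i, ∑ j, g i j := by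
    simp_rw [sum_comm (s := (univ : Finset (Fin n))) (t := (univ : Finset (Equiv.Perm (Fin n))))]
    refine sum_congr rfl fun π _ => ?_
    rw [← Equiv.sum_comp π fun i => ∑ j, g i j]
    exact sum_congr rfl fun i _ => Equiv.sum_comp π fun j => g (π i) j
  rw [← h1, h2]
  simp [Fintype.card_perm]

/-! ### Moments of linear functions on the slice -/

lemma sum_mem_eq_sum_ite {n : ℕ} (T : Finset (Fin n)) (s : Fin n → ℝ) :
    ∑ i ∈ T, s i = ∑ i, s i * if i ∈ T then 1 else 0 := by
  simp

lemma sliceExp_mem {n k : ℕ} (hk : k ≤ n) (i : Fin n) :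
    sliceExp n k (fun T => if i ∈ T then 1 else 0) = k / n := by
  have hn : (n : ℝ) ≠ 0 := by have := i.pos; positivity
  have key : ∀ j : Fin n, sliceExp n k (fun T => if j ∈ T then 1 else 0)
      = sliceExp n k (fun T => if i ∈ T then 1 else 0) := by
    intro j
    rw [← sliceExp_map_perm k (Equiv.swap i j)]
    refine sliceExp_congr fun T _ => ?_
    congr 1
    simp [mem_map_equiv]
  have h1 : sliceExp n k (fun T => ∑ j, if j ∈ T then 1 else 0) = k := by
    rw [← sliceExp_const hk (k : ℝ)]
    refine sliceExp_congr fun T hT => ?_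
    simp [mem_theSlice.1 hT]
  rw [sliceExp_sum, sum_congr rfl fun j _ => key j] at h1
  rw [eq_div_iff hn, ← h1]
  simp [mul_comm]

lemma sliceExp_mem_pair {n k : ℕ} (hk : k ≤ n) {i j : Fin n} (hij : i ≠ j) :
    sliceExp n k (fun T => (if i ∈ T then 1 else 0) * if j ∈ T then 1 else 0)
      = k * (k - 1) / (n * (n - 1)) := by
  have hn : 2 ≤ n := by
    have := i.2; have := j.2
    have : (i : ℕ) ≠ j := fun h => hij (Fin.ext h)
    omega
  have hn' : (2 : ℝ) ≤ n := by exact_mod_cast hn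
  have hne : (n * (n - 1) : ℝ) ≠ 0 := by
    have : (0 : ℝ) < n - 1 := by linarith
    positivity
  set R := sliceExp n k (fun T => (if i ∈ T then 1 else 0) * if j ∈ T then 1 else 0) with hR
  have key : ∀ a b : Fin n,
      sliceExp n k (fun T => (if a ∈ T then 1 else 0) * if b ∈ T then 1 else 0)
      = R + if a = b then k / n - R else 0 := by
    intro a b
    by_cases hab : a = b
    · subst hab
      rw [if_pos rfl, add_sub_cancel, ← sliceExp_mem hk a]
      exact sliceExp_congr fun T _ => by split_ifs <;> simp
    · obtain ⟨π, rfl, rfl⟩ := exists_perm_apply_pair hij hab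
      rw [if_neg hab, add_zero, hR, ← sliceExp_map_perm k π]
      exact sliceExp_congr fun T _ => by simp
  have h1 : sliceExp n k (fun T => ∑ a, ∑ b, (if a ∈ T then 1 else 0) * if b ∈ T then 1 else 0)
      = k * k := by
    rw [← sliceExp_const hk (k * k : ℝ)]
    refine sliceExp_congr fun T hT => ?_
    rw [← sum_mul_sum]
    simp [mem_theSlice.1 hT]
  simp only [sliceExp_sum, key, sum_add_distrib, sum_ite_eq, mem_univ, if_true, sum_const,
    card_univ, Fintype.card_fin, nsmul_eq_mul] at h1
  have hn0 : (n : ℝ) ≠ 0 := by positivity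
  rw [eq_div_iff hne]
  have : (n : ℝ) * (k / n - R) = k - n * R := by field_simp
  linarith

lemma pair_density_le_sq {n k : ℝ} (hn : 1 < n) (hk : 0 ≤ k) (hkn : k ≤ n) :
    k * (k - 1) / (n * (n - 1)) ≤ (k / n) ^ 2 := by
  rw [div_pow, div_le_div_iff₀ (by nlinarith) (by positivity)]
  nlinarith [mul_nonneg (by positivity : 0 ≤ n * k) (by linarith : 0 ≤ n - k)]

lemma sliceExp_linear {n k : ℕ} (hk : k ≤ n) (s : Fin n → ℝ) :
    sliceExp n k (fun T => ∑ i ∈ T, s i) = k / n * ∑ i, s i := by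
  simp_rw [sum_mem_eq_sum_ite _ s, sliceExp_sum, sliceExp_const_mul, sliceExp_mem hk,
    mem_univ, if_true, mul_one, ← sum_mul]
  ring

lemma sliceExp_linear_sq {n k : ℕ} (hk : k ≤ n) (s : Fin n → ℝ) :
    sliceExp n k (fun T => (∑ i ∈ T, s i) ^ 2)
      = (k / n - k * (k - 1) / (n * (n - 1))) * ∑ i, s i ^ 2
        + k * (k - 1) / (n * (n - 1)) * (∑ i, s i) ^ 2 := by
  set R : ℝ := k * (k - 1) / (n * (n - 1)) with hR
  have key : ∀ a b : Fin n,
      sliceExp n k (fun T => (s a * if a ∈ T then 1 else 0) * (s b * if b ∈ T then 1 else 0))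
      = R * (s a * s b) + if a = b then (k / n - R) * (s a * s b) else 0 := by
    intro a b
    have : sliceExp n k (fun T => (s a * if a ∈ T then 1 else 0) * (s b * if b ∈ T then 1 else 0))
        = s a * s b *
          sliceExp n k (fun T => (if a ∈ T then 1 else 0) * if b ∈ T then 1 else 0) := by
      rw [← sliceExp_const_mul]
      exact sliceExp_congr fun T _ => by ring
    rw [this]
    by_cases hab : a = b
    · subst hab
      rw [if_pos rfl]
      have : sliceExp n k (fun T => (if a ∈ T then 1 else 0) * if a ∈ T then 1 else 0)
          = k / n := by
        rw [← sliceExp_mem hk a]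
        exact sliceExp_congr fun T _ => by split_ifs <;> simp
      rw [this]; ring
    · rw [if_neg hab, sliceExp_mem_pair hk hab]; ring
  simp_rw [sum_mem_eq_sum_ite _ s, sq, sum_mul_sum, sliceExp_sum, key, sum_add_distrib,
    sum_ite_eq, mem_univ, if_true, mul_sum]
  ring_nf

/-! ### Linear functions on the cube -/

lemma sum_powerset_affine_sq {ι : Type*} [DecidableEq ι] (s : Finset ι) (u v : ι → ℝ) (b : ℝ) :
    ∑ t ∈ s.powerset, (b + ∑ i ∈ t, u i + ∑ i ∈ s \ t, v i) ^ 2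
      = 2 ^ s.card * ((b + ∑ i ∈ s, (u i + v i) / 2) ^ 2 + ∑ i ∈ s, ((u i - v i) / 2) ^ 2) := by
  induction s using Finset.induction_on generalizing b with
  | empty => simp
  | insert a s ha ih =>
    rw [sum_powerset_insert ha]
    have h1 : ∀ t ∈ s.powerset, (b + ∑ i ∈ t, u i + ∑ i ∈ insert a s \ t, v i) ^ 2
        = ((b + v a) + ∑ i ∈ t, u i + ∑ i ∈ s \ t, v i) ^ 2 := by
      intro t ht
      have hat : a ∉ t := fun h => ha (mem_powerset.1 ht h)
      rw [insert_sdiff_of_notMem _ hat, sum_insert (by simp [ha])]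
      ring
    have h2 : ∀ t ∈ s.powerset,
        (b + ∑ i ∈ insert a t, u i + ∑ i ∈ insert a s \ insert a t, v i) ^ 2
        = ((b + u a) + ∑ i ∈ t, u i + ∑ i ∈ s \ t, v i) ^ 2 := by
      intro t ht
      have hat : a ∉ t := fun h => ha (mem_powerset.1 ht h)
      have : insert a s \ insert a t = s \ t := by
        ext x
        simp only [mem_sdiff, mem_insert]
        constructor
        · tauto
        · rintro ⟨hx, hxt⟩
          refine ⟨Or.inr hx, ?_⟩
          rintro (rfl | h)
          · exact ha hx
          · exact hxt h
      rw [this, sum_insert hat]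
      ring
    rw [sum_congr rfl h1, sum_congr rfl h2, ih, ih, sum_insert ha, sum_insert ha,
      card_insert_of_notMem ha]
    ring

lemma norm_exp_add_exp (x y : ℝ) :
    ‖Complex.exp (2 * Real.pi * x * Complex.I) + Complex.exp (2 * Real.pi * y * Complex.I)‖
      = 2 * |Real.cos (Real.pi * (x - y))| := by
  have : Complex.exp (2 * Real.pi * x * Complex.I) + Complex.exp (2 * Real.pi * y * Complex.I)
      = Complex.exp ((Real.pi * (x + y) : ℝ) * Complex.I) *
        ((2 * Real.cos (Real.pi * (x - y)) : ℝ) : ℂ) := by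
    push_cast
    rw [Complex.two_cos, mul_add, ← Complex.exp_add, ← Complex.exp_add]
    congr 2 <;> ring
  rw [this, norm_mul, Complex.norm_exp_ofReal_mul_I, one_mul, Complex.norm_real, Real.norm_eq_abs,
    abs_mul, abs_two]

lemma abs_cos_pi_mul_le (x : ℝ) :
    |Real.cos (Real.pi * x)| ≤ 1 - 2 * (x - round x) ^ 2 := by
  have hx := abs_sub_round x
  have h1 : |Real.cos (Real.pi * x)| = |Real.cos (Real.pi * (x - round x))| := by
    have : Real.pi * (x - round x) = Real.pi * x - round x * Real.pi := by ring
    rw [this, Real.cos_sub_int_mul_pi, abs_mul]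
    rcases Int.even_or_odd (round x) with h | h <;> simp [h.neg_one_zpow]
  have hπ := Real.pi_pos
  have h2 : |Real.pi * (x - round x)| ≤ Real.pi / 2 := by
    rw [abs_mul, abs_of_pos hπ]; nlinarith
  rw [h1, abs_of_nonneg (Real.cos_nonneg_of_mem_Icc
    ⟨by linarith [(abs_le.1 h2).1], (abs_le.1 h2).2⟩)]
  have h3 := Real.cos_le_one_sub_mul_cos_sq (h2.trans (by linarith))
  have h4 : 2 / Real.pi ^ 2 * (Real.pi * (x - round x)) ^ 2 = 2 * (x - round x) ^ 2 := by
    field_simp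
  linarith

lemma sum_le_of_one_sub_le_prod {ι : Type*} (s : Finset ι) (y z : ι → ℝ) {η : ℝ}
    (hη : η ≤ 1 / 2) (hz : ∀ i ∈ s, 0 ≤ z i) (hy : ∀ i ∈ s, 0 ≤ y i)
    (hyz : ∀ i ∈ s, z i ≤ 1 - 2 * y i) (h : 1 - η ≤ ∏ i ∈ s, z i) :
    ∑ i ∈ s, y i ≤ η := by
  have h1 : ∏ i ∈ s, z i ≤ Real.exp (-(2 * ∑ i ∈ s, y i)) := by
    rw [mul_sum, ← sum_neg_distrib, Real.exp_sum]
    refine prod_le_prod hz fun i hi => (hyz i hi).trans ?_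
    linarith [Real.add_one_le_exp (-(2 * y i))]
  set Y := ∑ i ∈ s, y i
  have hY : 0 ≤ Y := sum_nonneg hy
  have h2 : (1 - η) * (1 + 2 * Y) ≤ 1 := by
    calc (1 - η) * (1 + 2 * Y) ≤ Real.exp (-(2 * Y)) * Real.exp (2 * Y) := by
          refine mul_le_mul (h.trans h1) ?_ (by linarith) (Real.exp_pos _).le
          linarith [Real.add_one_le_exp (2 * Y)]
      _ = 1 := by rw [← Real.exp_add]; simp
  nlinarith

lemma one_sub_le_cos_two_pi_mul {F x : ℝ} (hF : F = 0 ∨ F = 1) :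
    1 - 20 * (F - x) ^ 2 ≤ Real.cos (2 * Real.pi * x) := by
  have h1 : Real.cos (2 * Real.pi * x) = Real.cos (2 * Real.pi * (x - F)) := by
    rcases hF with rfl | rfl
    · simp
    · rw [mul_sub, mul_one, Real.cos_sub_two_pi]
  have h2 := Real.one_sub_sq_div_two_le_cos (x := 2 * Real.pi * (x - F))
  have h3 : Real.pi ^ 2 ≤ 10 := by nlinarith [Real.pi_lt_d2, Real.pi_pos]
  rw [h1]
  nlinarith [mul_le_mul_of_nonneg_right h3 (sq_nonneg (F - x))]

lemma sum_sub_round_sq_le_of_cube {ι : Type*} [DecidableEq ι] (s : Finset ι) (u v : ι → ℝ) (b δ : ℝ)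
    (F : Finset ι → ℝ) (hF : ∀ t, F t = 0 ∨ F t = 1)
    (h : ∑ t ∈ s.powerset, (F t - (b + ∑ i ∈ t, u i + ∑ i ∈ s \ t, v i)) ^ 2 ≤ 2 ^ s.card * δ) :
    ∑ i ∈ s, (u i - v i - round (u i - v i)) ^ 2 ≤ 88 * δ := by
  set L : Finset ι → ℝ := fun t => b + ∑ i ∈ t, u i + ∑ i ∈ s \ t, v i with hL
  have h2 : (0 : ℝ) < 2 ^ s.card := by positivity
  have hcard : ∀ a : ℝ, ∑ t ∈ s.powerset, a = 2 ^ s.card * a := by simp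
  rcases le_or_gt δ (1 / 40) with hδ | hδ
  · have hcos : 2 ^ s.card * (1 - 20 * δ) ≤ ∑ t ∈ s.powerset, Real.cos (2 * Real.pi * L t) := by
      calc 2 ^ s.card * (1 - 20 * δ)
          ≤ ∑ t ∈ s.powerset, (1 - 20 * (F t - L t) ^ 2) := by
            rw [sum_sub_distrib, ← mul_sum, hcard]
            linarith
        _ ≤ _ := sum_le_sum fun t _ => one_sub_le_cos_two_pi_mul (hF t)
    have hexp : ∑ t ∈ s.powerset, Complex.exp (2 * Real.pi * (L t : ℝ) * Complex.I)
        = Complex.exp (2 * Real.pi * b * Complex.I) *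
          ∏ i ∈ s, (Complex.exp (2 * Real.pi * u i * Complex.I)
            + Complex.exp (2 * Real.pi * v i * Complex.I)) := by
      rw [prod_add, mul_sum]
      refine sum_congr rfl fun t _ => ?_
      rw [← Complex.exp_sum, ← Complex.exp_sum, ← Complex.exp_add, ← Complex.exp_add]
      congr 1
      simp only [hL]
      push_cast
      simp only [mul_add, add_mul, mul_sum, sum_mul]
      ring
    have hprod : 1 - 20 * δ ≤ ∏ i ∈ s, |Real.cos (Real.pi * (u i - v i))| := by
      have h3 : ∑ t ∈ s.powerset, Real.cos (2 * Real.pi * L t)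
          ≤ 2 ^ s.card * ∏ i ∈ s, |Real.cos (Real.pi * (u i - v i))| := by
        calc ∑ t ∈ s.powerset, Real.cos (2 * Real.pi * L t)
            = (∑ t ∈ s.powerset, Complex.exp (2 * Real.pi * (L t : ℝ) * Complex.I)).re := by
              rw [Complex.re_sum]
              refine sum_congr rfl fun t _ => ?_
              rw [← Complex.exp_ofReal_mul_I_re]
              push_cast
              rfl
          _ ≤ ‖∑ t ∈ s.powerset, Complex.exp (2 * Real.pi * (L t : ℝ) * Complex.I)‖ :=
              Complex.re_le_norm _
          _ = _ := by
              rw [hexp, norm_mul, norm_prod]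
              simp_rw [norm_exp_add_exp]
              rw [prod_mul_distrib, prod_const]
              have : ‖Complex.exp (2 * Real.pi * b * Complex.I)‖ = 1 := by
                have := Complex.norm_exp_ofReal_mul_I (2 * Real.pi * b)
                push_cast at this
                exact this
              rw [this, one_mul]
      exact le_of_mul_le_mul_left (hcos.trans h3) h2
    have hnonneg : 0 ≤ δ := by
      have := (sum_nonneg fun t _ => sq_nonneg (F t - L t)).trans h
      exact nonneg_of_mul_nonneg_right this h2
    have := sum_le_of_one_sub_le_prod s (fun i => (u i - v i - round (u i - v i)) ^ 2)
      _ (by linarith) (fun i _ => abs_nonneg _) (fun i _ => sq_nonneg _)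
      (fun i _ => abs_cos_pi_mul_le _) hprod
    linarith
  · have h3 := sum_powerset_affine_sq s u v (b - 1 / 2)
    have h4 : ∑ t ∈ s.powerset, (b - 1 / 2 + ∑ i ∈ t, u i + ∑ i ∈ s \ t, v i) ^ 2
        ≤ 2 ^ s.card * (2 * δ + 1 / 2) := by
      calc _ ≤ ∑ t ∈ s.powerset, (2 * (F t - L t) ^ 2 + 1 / 2) := by
            refine sum_le_sum fun t _ => ?_
            have : b - 1 / 2 + ∑ i ∈ t, u i + ∑ i ∈ s \ t, v i = L t - 1 / 2 := by
              simp only [hL]; ring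
            rw [this]
            rcases hF t with h | h <;> rw [h]
            · nlinarith [sq_nonneg (L t + 1 / 2)]
            · nlinarith [sq_nonneg (L t - 3 / 2)]
        _ ≤ _ := by
            rw [sum_add_distrib, ← mul_sum, hcard]
            linarith
    rw [h3] at h4
    have h5 := le_of_mul_le_mul_left h4 h2
    have h6 : ∑ i ∈ s, (u i - v i - round (u i - v i)) ^ 2
        ≤ 4 * ∑ i ∈ s, ((u i - v i) / 2) ^ 2 := by
      rw [mul_sum]
      refine sum_le_sum fun i _ => ?_
      have := sq_le_sq.2 (by simpa using round_le (u i - v i) 0)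
      linarith
    nlinarith [sq_nonneg (b - 1 / 2 + ∑ i ∈ s, (u i + v i) / 2)]

/-! ### Integrality of the coefficients -/

lemma exists_sum_sub_round_sq_le {n k : ℕ} (hk : 0 < k) (hkn : 2 * k ≤ n)
    {f : Finset (Fin n) → ℝ} (hf : ∀ T ∈ theSlice n k, f T = 0 ∨ f T = 1)
    {b : ℝ} {c : Fin n → ℝ} {ε : ℝ}
    (h : sliceExp n k (fun T => (f T - (b + ∑ i ∈ T, c i)) ^ 2) ≤ ε) :
    ∃ m : ℝ, (k / n : ℝ) * ∑ i, (c i - m - round (c i - m)) ^ 2 ≤ 88 * ε := by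
  have hn : (1 : ℝ) ≤ n := by exact_mod_cast (by omega : 1 ≤ n)
  have hε : 0 ≤ ε := by
    refine le_trans ?_ h
    rw [← sliceExp_const (show k ≤ n by omega) (0 : ℝ)]
    exact sliceExp_mono fun T _ => sq_nonneg _
  let α : Fin k ↪ Fin n := ⟨fun j => ⟨j, by omega⟩, fun i j hij => by
    simpa [Fin.ext_iff] using hij⟩
  let β : Fin k ↪ Fin n := ⟨fun j => ⟨k + j, by omega⟩, fun i j hij => by
    simpa [Fin.ext_iff] using hij⟩
  have hαβ : ∀ i j, α i ≠ β j := fun i j hij => by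
    have : (i : ℕ) = k + j := congrArg Fin.val hij
    omega
  have hdisj : ∀ t : Finset (Fin k), Disjoint (t.map α) ((univ \ t).map β) := by
    intro t
    rw [disjoint_left]
    rintro x hx hy
    obtain ⟨i, _, rfl⟩ := mem_map.1 hx
    obtain ⟨j, _, hj⟩ := mem_map.1 hy
    exact hαβ i j hj.symm
  let U : Finset (Fin k) → Finset (Fin n) := fun t =>
    (t.map α).disjUnion ((univ \ t).map β) (hdisj t)
  have hU : ∀ t, (U t).card = k := by
    intro t
    have := card_le_univ t
    simp only [U, card_disjUnion, card_map, card_univ_sdiff, Fintype.card_fin] at this ⊢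
    omega
  have hsum : ∀ (π : Equiv.Perm (Fin n)) (t : Finset (Fin k)),
      b + ∑ i ∈ (U t).map π.toEmbedding, c i
        = b + ∑ j ∈ t, c (π (α j)) + ∑ j ∈ univ \ t, c (π (β j)) := by
    intro π t
    simp only [U, sum_map, sum_disjUnion, Equiv.coe_toEmbedding]
    ring
  set D : Equiv.Perm (Fin n) → ℝ := fun π =>
    (∑ t ∈ (univ : Finset (Fin k)).powerset, (f ((U t).map π.toEmbedding) -
      (b + ∑ j ∈ t, c (π (α j)) + ∑ j ∈ univ \ t, c (π (β j)))) ^ 2) / 2 ^ k with hD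
  have hcube : ∀ π : Equiv.Perm (Fin n),
      ∑ j, (c (π (α j)) - c (π (β j)) - round (c (π (α j)) - c (π (β j)))) ^ 2 ≤ 88 * D π := by
    intro π
    refine sum_sub_round_sq_le_of_cube univ (fun j => c (π (α j))) (fun j => c (π (β j))) b (D π)
      (fun t => f ((U t).map π.toEmbedding)) (fun t => hf _ ?_) ?_
    · rw [mem_theSlice, card_map, hU]
    · rw [hD, card_univ, Fintype.card_fin]
      exact (mul_div_cancel₀ _ (by positivity)).ge
  have hDsum : ∑ π, D π ≤ n.factorial * ε := by
    rw [hD, ← sum_div, sum_comm, div_le_iff₀ (by positivity)]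
    calc _ = ∑ t ∈ (univ : Finset (Fin k)).powerset, (n.factorial : ℝ) *
          sliceExp n k (fun T => (f T - (b + ∑ i ∈ T, c i)) ^ 2) := by
          refine sum_congr rfl fun t _ => ?_
          rw [← sum_perm_map_eq (by omega) (hU t)]
          simp only [hsum]
      _ ≤ ∑ t ∈ (univ : Finset (Fin k)).powerset, (n.factorial : ℝ) * ε := by gcongr
      _ = _ := by simp [mul_comm]
  set ψ : Fin n → Fin n → ℝ := fun i j => (c i - c j - round (c i - c j)) ^ 2 with hψ
  have hpair : (n * (n - 1) : ℝ) * ∑ π : Equiv.Perm (Fin n), ∑ j, ψ (π (α j)) (π (β j))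
      = k * (n.factorial * ∑ i, ∑ j, ψ i j) := by
    rw [sum_comm, mul_sum, sum_congr rfl fun j _ => sum_perm_pair (hαβ j j) ψ (by simp [hψ])]
    simp
  have htotal : (k : ℝ) * ∑ j, ∑ i, ψ i j ≤ n * (n - 1) * (88 * ε) := by
    have h1 : ∑ π : Equiv.Perm (Fin n), ∑ j, ψ (π (α j)) (π (β j)) ≤ n.factorial * (88 * ε) := by
      calc _ ≤ ∑ π, 88 * D π := sum_le_sum fun π _ => hcube π
        _ ≤ _ := by rw [← mul_sum]; linarith
    have hfac : (0 : ℝ) < n.factorial := by exact_mod_cast n.factorial_pos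
    have h2 := mul_le_mul_of_nonneg_left h1 (show (0 : ℝ) ≤ n * (n - 1) by nlinarith)
    rw [hpair] at h2
    rw [sum_comm]
    refine le_of_mul_le_mul_left (le_trans (le_of_eq ?_) (h2.trans (le_of_eq ?_))) hfac <;> ring
  have hne : (univ : Finset (Fin n)).Nonempty := ⟨⟨0, by omega⟩, mem_univ _⟩
  obtain ⟨j, _, hj⟩ := exists_le_of_sum_le hne
    (f := fun j => (k : ℝ) * ∑ i, ψ i j) (g := fun _ => (n - 1 : ℝ) * (88 * ε)) (by
      rw [← mul_sum]
      simpa [mul_assoc] using htotal)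
  refine ⟨c j, ?_⟩
  rw [div_mul_eq_mul_div, div_le_iff₀ (by linarith)]
  refine hj.trans ?_
  nlinarith

lemma sliceExp_int_mul_sub_one_le {n k : ℕ} {f : Finset (Fin n) → ℝ}
    (hf : ∀ T ∈ theSlice n k, f T = 0 ∨ f T = 1) (h : Finset (Fin n) → ℤ) {δ : ℝ}
    (hδ : sliceExp n k (fun T => (f T - h T) ^ 2) ≤ δ) :
    sliceExp n k (fun T => (h T : ℝ) * (h T - 1)) ≤ 2 * δ := by
  calc _ ≤ sliceExp n k (fun T => 2 * (f T - h T) ^ 2) := by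
        refine sliceExp_mono fun T hT => ?_
        have hsq : ∀ z : ℤ, (0 : ℝ) ≤ z * (z + 1) := fun z => by
          have : 0 ≤ z * (z + 1) := by
            rcases le_or_gt 0 z with h | h <;> nlinarith
          exact_mod_cast this
        rcases hf T hT with h0 | h0 <;> rw [h0]
        · nlinarith [hsq (h T)]
        · have := hsq (h T - 2)
          push_cast at this
          nlinarith
    _ ≤ 2 * δ := by rw [sliceExp_const_mul]; linarith

lemma exists_int_coeff {n k : ℕ} (hk : 2 ≤ k) (hkn : 2 * k ≤ n)
    {f : Finset (Fin n) → ℝ} (hf : ∀ T ∈ theSlice n k, f T = 0 ∨ f T = 1)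
    {b : ℝ} {c : Fin n → ℝ} {ε : ℝ}
    (h : sliceExp n k (fun T => (f T - (b + ∑ i ∈ T, c i)) ^ 2) ≤ ε) :
    ∃ (B : ℤ) (s : Fin n → ℤ),
      sliceExp n k (fun T => (f T - (B + ∑ i ∈ T, s i : ℤ)) ^ 2) ≤ 712 * ε := by
  have hkn' : k ≤ n := by omega
  have hn : (2 : ℝ) ≤ n := by exact_mod_cast (by omega : 2 ≤ n)
  have hkR : (2 : ℝ) ≤ k := by exact_mod_cast hk
  have hkn2 : (2 * k : ℝ) ≤ n := by exact_mod_cast hkn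
  obtain ⟨m, hm⟩ := exists_sum_sub_round_sq_le (by omega) hkn hf h
  set s : Fin n → ℤ := fun i => round (c i - m) with hs
  set e : Fin n → ℝ := fun i => c i - m - s i with he
  set b₀ : ℝ := b + k * m + k / n * ∑ i, e i with hb₀
  have h1 : sliceExp n k (fun T => ((b + ∑ i ∈ T, c i) - (b₀ + ∑ i ∈ T, (s i : ℝ))) ^ 2)
      ≤ 88 * ε := by
    have h2 : sliceExp n k (fun T => ((b + ∑ i ∈ T, c i) - (b₀ + ∑ i ∈ T, (s i : ℝ))) ^ 2)
        = sliceExp n k (fun T => (∑ i ∈ T, e i) ^ 2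
          + (-(2 * (k / n * ∑ i, e i)) * ∑ i ∈ T, e i + (k / n * ∑ i, e i) ^ 2)) := by
      refine sliceExp_congr fun T hT => ?_
      have : ∑ i ∈ T, c i = ∑ i ∈ T, e i + k * m + ∑ i ∈ T, (s i : ℝ) := by
        simp only [he, sum_sub_distrib, sum_const, mem_theSlice.1 hT, nsmul_eq_mul]
        ring
      rw [this, hb₀]
      ring
    rw [h2, sliceExp_add, sliceExp_add, sliceExp_const_mul, sliceExp_const hkn',
      sliceExp_linear hkn', sliceExp_linear_sq hkn']
    have h3 := pair_density_le_sq (by linarith : (1 : ℝ) < n) (by positivity)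
      (by linarith : (k : ℝ) ≤ n)
    have h4 : (0 : ℝ) ≤ k * (k - 1) / (n * (n - 1)) :=
      div_nonneg (by nlinarith) (by nlinarith)
    have h5 := mul_le_mul_of_nonneg_right h3 (sq_nonneg (∑ i, e i))
    have h6 : 0 ≤ ∑ i, e i ^ 2 := sum_nonneg fun i _ => sq_nonneg _
    nlinarith [mul_nonneg h4 h6]
  have h7 := sliceExp_sq_sub_le h h1
  have h8 : (b₀ - round b₀) ^ 2 ≤ 178 * ε := by
    rw [← sliceExp_const hkn' ((b₀ - round b₀) ^ 2)]
    refine le_trans (sliceExp_mono fun T hT => ?_) (h7.trans (by linarith))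
    have key : ∀ z : ℤ, (b₀ - round b₀) ^ 2 ≤ (z - (b₀ + ∑ i ∈ T, (s i : ℝ))) ^ 2 := by
      intro z
      rw [sq_le_sq]
      refine (round_le b₀ (z - ∑ i ∈ T, s i)).trans (le_of_eq ?_)
      rw [abs_sub_comm]
      push_cast
      congr 1
      ring
    rcases hf T hT with h0 | h0 <;> rw [h0]
    · simpa using key 0
    · simpa using key 1
  refine ⟨round b₀, s, ?_⟩
  refine (sliceExp_sq_sub_le (b := 178 * ε) h7 ?_).trans (le_of_eq (by ring))
  refine (le_of_eq ?_).trans h8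
  rw [← sliceExp_const hkn' ((b₀ - round b₀) ^ 2)]
  refine sliceExp_congr fun T _ => ?_
  push_cast
  ring

/-! ### Boolean functions close to integer-valued linear functions -/

lemma sliceExp_sub_maxInd_sq_le {n k : ℕ} (S : Finset (Fin n)) :
    sliceExp n k (fun T => (((S ∩ T).card : ℝ) - maxInd S T) ^ 2)
      ≤ sliceExp n k (fun T => ((S ∩ T).card : ℝ) * ((S ∩ T).card - 1)) := by
  refine sliceExp_mono fun T _ => ?_
  unfold maxInd
  split_ifs with h
  · have : (1 : ℝ) ≤ (S ∩ T).card := by exact_mod_cast h.card_pos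
    nlinarith
  · rw [not_nonempty_iff_eq_empty] at h
    simp [h]

lemma close_to_maxInd_of_close_to_card {n k : ℕ} (hk : 2 ≤ k) (hkn : k + 2 ≤ n)
    {f : Finset (Fin n) → ℝ} (hf : ∀ T ∈ theSlice n k, f T = 0 ∨ f T = 1)
    (S : Finset (Fin n)) {δ : ℝ}
    (hδ : sliceExp n k (fun T => (f T - ((S ∩ T).card : ℤ)) ^ 2) ≤ δ) :
    (S.card ≤ 1 ∨ ((k / n : ℝ) * S.card) ^ 2 ≤ 8 * δ) ∧
      sliceExp n k (fun T => (f T - maxInd S T) ^ 2) ≤ 6 * δ := by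
  have hkR : (2 : ℝ) ≤ k := by exact_mod_cast hk
  have hn : (k + 2 : ℝ) ≤ n := by exact_mod_cast hkn
  have h1 := sliceExp_int_mul_sub_one_le hf _ hδ
  push_cast at h1 hδ
  refine ⟨?_, (sliceExp_sq_sub_le hδ ((sliceExp_sub_maxInd_sq_le S).trans h1)).trans
    (le_of_eq (by ring))⟩
  by_cases hS : S.card ≤ 1
  · exact Or.inl hS
  right
  have hN : (2 : ℝ) ≤ S.card := by exact_mod_cast (by omega : 2 ≤ S.card)
  have h2 : sliceExp n k (fun T => ((S ∩ T).card : ℝ) * ((S ∩ T).card - 1))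
      = k * (k - 1) / (n * (n - 1)) * (S.card * (S.card - 1)) := by
    have hcard : ∀ T : Finset (Fin n),
        ((S ∩ T).card : ℝ) = ∑ i ∈ T, if i ∈ S then (1 : ℝ) else 0 := by
      intro T
      simp [inter_comm]
    have : sliceExp n k (fun T => ((S ∩ T).card : ℝ) * ((S ∩ T).card - 1))
        = sliceExp n k (fun T => (∑ i ∈ T, if i ∈ S then (1 : ℝ) else 0) ^ 2
          + (-1) * ∑ i ∈ T, if i ∈ S then (1 : ℝ) else 0) :=
      sliceExp_congr fun T _ => by rw [hcard]; ring
    rw [this, sliceExp_add, sliceExp_const_mul, sliceExp_linear (by omega),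
      sliceExp_linear_sq (by omega)]
    simp
    ring
  rw [h2] at h1
  have h3 : (k / n : ℝ) ^ 2 ≤ 2 * (k * (k - 1) / (n * (n - 1))) := by
    rw [div_pow, mul_div_assoc', div_le_div_iff₀ (by nlinarith) (by nlinarith)]
    have : (k : ℝ) * (n - 1) ≤ 2 * (k - 1) * n := by nlinarith
    nlinarith [mul_le_mul_of_nonneg_left this (by nlinarith : (0 : ℝ) ≤ k * n)]
  have h4 : (S.card : ℝ) ^ 2 ≤ 2 * (S.card * (S.card - 1)) := by nlinarith
  rw [mul_pow]
  nlinarith [mul_le_mul h3 h4 (sq_nonneg _) (by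
    have : (0 : ℝ) ≤ k * (k - 1) / (n * (n - 1)) := div_nonneg (by nlinarith) (by nlinarith)
    linarith)]

lemma sliceExp_affine_mul_sub_one {n k : ℕ} (hk : k ≤ n) (B : ℝ) (s : Fin n → ℝ) :
    sliceExp n k (fun T => (B + ∑ i ∈ T, s i) * (B + ∑ i ∈ T, s i - 1))
      = (k / n - k * (k - 1) / (n * (n - 1))) * ∑ i, s i ^ 2
        + k * (k - 1) / (n * (n - 1)) * (∑ i, s i) ^ 2
        + (2 * B - 1) * (k / n * ∑ i, s i) + B * (B - 1) := by
  have : sliceExp n k (fun T => (B + ∑ i ∈ T, s i) * (B + ∑ i ∈ T, s i - 1))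
      = sliceExp n k (fun T => (∑ i ∈ T, s i) ^ 2
        + ((2 * B - 1) * ∑ i ∈ T, s i + B * (B - 1))) :=
    sliceExp_congr fun T _ => by ring
  rw [this, sliceExp_add, sliceExp_add, sliceExp_const_mul, sliceExp_const hk, sliceExp_linear hk,
    sliceExp_linear_sq hk]
  ring

lemma const_eq_zero_or_one {n k : ℕ} (hk : 2 ≤ k) (hkn : 2 * k ≤ n) {B A : ℤ} {Q η : ℝ}
    (hA : 0 ≤ A) (hAn : 2 * A ≤ n) (hQ : (A : ℝ) ≤ Q) (hη : η ≤ 1 / 200)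
    (h : (k / n - k * (k - 1) / (n * (n - 1)) : ℝ) * Q + k * (k - 1) / (n * (n - 1)) * (A : ℝ) ^ 2
        + (2 * B - 1) * (k / n * A) + B * (B - 1) ≤ η) :
    B = 0 ∨ B = 1 := by
  have hkR : (2 : ℝ) ≤ k := by exact_mod_cast hk
  have hnR : (2 * k : ℝ) ≤ n := by exact_mod_cast hkn
  have hn1 : (0 : ℝ) < n - 1 := by linarith
  have hn0 : (0 : ℝ) < n := by linarith
  have hAR : (0 : ℝ) ≤ A := by exact_mod_cast hA
  have hAnR : (2 * A : ℝ) ≤ n := by exact_mod_cast hAn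
  set a : ℝ := A / n with ha
  set w : ℝ := k * (n - k) / (n - 1) with hw
  have hAa : (A : ℝ) = n * a := by rw [ha]; field_simp
  have ha0 : 0 ≤ a := by positivity
  have ha1 : a ≤ 1 / 2 := by rw [ha, div_le_iff₀ hn0]; linarith
  have hqw : (k / n - k * (k - 1) / (n * (n - 1)) : ℝ) = w / n := by
    rw [hw]; field_simp; ring
  have hw1 : 4 / 3 ≤ w := by
    rw [hw, div_le_div_iff₀ (by norm_num) hn1]
    nlinarith [mul_nonneg (by linarith : (0 : ℝ) ≤ k - 2) (by linarith : (0 : ℝ) ≤ n - k - 2)]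
  have hw2 : k / 2 ≤ w := by
    rw [hw, div_le_div_iff₀ (by norm_num) hn1]
    nlinarith
  have hmain : w * (a * (1 - a)) + (B + k * a) * (B + k * a - 1) ≤ η := by
    have h1 : w / n * (A : ℝ) ≤ w / n * Q := by gcongr
    have h2 : w / n * (A : ℝ) + k * (k - 1) / (n * (n - 1)) * (A : ℝ) ^ 2
        + (2 * B - 1) * (k / n * A) + B * (B - 1)
        = w * (a * (1 - a)) + (B + k * a) * (B + k * a - 1) := by
      rw [hAa, hw]; field_simp; ring
    rw [hqw] at h
    linarith
  have haa : 0 ≤ a * (1 - a) := mul_nonneg ha0 (by linarith)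
  have h3 : w * (a * (1 - a)) ≤ 51 / 200 := by nlinarith [sq_nonneg ((B : ℝ) + k * a - 1 / 2)]
  have h4 : a ≤ 26 / 100 := by
    by_contra! hlt
    have : a * (1 - a) ≤ 51 / 200 * (3 / 4) := by nlinarith
    nlinarith
  have h5 : k * a ≤ 69 / 100 := by
    have h6 : w * a * (74 / 100) ≤ 51 / 200 := by
      have : w * a * (74 / 100) ≤ w * a * (1 - a) := by gcongr; linarith
      linarith
    have h7 : k / 2 * a ≤ w * a := by gcongr
    linarith
  have h8 : 0 ≤ k * a := by positivity
  have h9 : ((B : ℝ) + k * a) * (B + k * a - 1) ≤ 1 / 200 := by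
    have : 0 ≤ w * (a * (1 - a)) := by positivity
    linarith
  have h10 : -1 < B := by
    by_contra! hB
    have : (B : ℝ) ≤ -1 := by exact_mod_cast hB
    nlinarith
  have h11 : B < 2 := by
    by_contra! hB
    have : (2 : ℝ) ≤ B := by exact_mod_cast hB
    nlinarith
  omega

lemma exists_maxInd_of_int_coeff_of_nonneg {n k : ℕ} (hk : 2 ≤ k) (hkn : 2 * k ≤ n)
    {f : Finset (Fin n) → ℝ} (hf : ∀ T ∈ theSlice n k, f T = 0 ∨ f T = 1)
    {B : ℤ} {s : Fin n → ℤ} {δ : ℝ} (hδ : δ ≤ 1 / 400)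
    (h : sliceExp n k (fun T => (f T - (B + ∑ i ∈ T, s i : ℤ)) ^ 2) ≤ δ)
    (hA : 0 ≤ ∑ i, s i) (hAn : 2 * ∑ i, s i ≤ n) :
    ∃ S : Finset (Fin n), (S.card ≤ 1 ∨ ((k / n : ℝ) * S.card) ^ 2 ≤ 176 * δ) ∧
      (sliceExp n k (fun T => (f T - maxInd S T) ^ 2) ≤ 132 * δ ∨
        sliceExp n k (fun T => ((1 - f T) - maxInd S T) ^ 2) ≤ 132 * δ) := by
  have hkn' : k ≤ n := by omega
  have hkR : (2 : ℝ) ≤ k := by exact_mod_cast hk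
  have hnR : (2 * k : ℝ) ≤ n := by exact_mod_cast hkn
  have hn1 : (0 : ℝ) < n - 1 := by linarith
  have hn0 : (0 : ℝ) < n := by linarith
  have hq0 : (0 : ℝ) ≤ k / n := by positivity
  have hR0 : (0 : ℝ) ≤ k * (k - 1) / (n * (n - 1)) :=
    div_nonneg (by nlinarith) (by nlinarith)
  have hδ0 : 0 ≤ δ := by
    refine le_trans ?_ h
    rw [← sliceExp_const hkn' (0 : ℝ)]
    exact sliceExp_mono fun T _ => sq_nonneg _
  have h1 := sliceExp_int_mul_sub_one_le hf _ h
  push_cast at h1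
  rw [sliceExp_affine_mul_sub_one hkn'] at h1
  have hAR : (0 : ℝ) ≤ ∑ i, (s i : ℝ) := by exact_mod_cast hA
  have hsq : ∀ z : ℤ, (0 : ℝ) ≤ z ^ 2 - z := fun z => by
    have : 0 ≤ z ^ 2 - z := by
      rcases le_or_gt z 0 with h | h <;> nlinarith
    exact_mod_cast this
  have hQ : ∑ i, (s i : ℝ) ≤ ∑ i, (s i : ℝ) ^ 2 :=
    sum_le_sum fun i _ => by linarith [hsq (s i)]
  have hB := const_eq_zero_or_one (B := B) (A := ∑ i, s i) (η := 2 * δ) hk hkn hA hAn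
    (by push_cast; exact hQ) (by linarith) (by push_cast; exact h1)
  have hqR : (k / n : ℝ) / 2 ≤ k / n - k * (k - 1) / (n * (n - 1)) := by
    have : (k / n - k * (k - 1) / (n * (n - 1)) - k / n / 2 : ℝ)
        = k * (n + 1 - 2 * k) / (2 * n * (n - 1)) := by
      field_simp; ring
    have : (0 : ℝ) ≤ k * (n + 1 - 2 * k) / (2 * n * (n - 1)) := by
      apply div_nonneg <;> apply mul_nonneg <;> linarith
    linarith
  rcases hB with rfl | rfl
  · set S : Finset (Fin n) := univ.filter fun i => s i = 1 with hS
    set r : Fin n → ℝ := fun i => s i - if i ∈ S then 1 else 0 with hr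
    have hr2 : ∀ i, r i ^ 2 ≤ 2 * ((s i : ℝ) ^ 2 - s i) := by
      intro i
      by_cases hi : s i = 1
      · simp [hr, hS, hi]
      · have : (0 : ℝ) ≤ (s i : ℝ) ^ 2 - 2 * s i := by
          have : 0 ≤ s i ^ 2 - 2 * s i := by
            rcases lt_or_gt_of_ne hi with h | h <;> nlinarith
          exact_mod_cast this
        simp only [hr, hS, mem_filter, hi]
        simp only [and_false, if_false]
        linarith
    have hrabs : ∀ i, |r i| ≤ r i ^ 2 := by
      intro i
      have : ∃ z : ℤ, r i = z := by
        refine ⟨s i - if i ∈ S then 1 else 0, ?_⟩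
        simp [hr]
      obtain ⟨z, hz⟩ := this
      rw [hz, abs_le]
      have h1 := hsq z
      have h2 := hsq (-z)
      push_cast at h2
      constructor <;> linarith
    have hsum : k / n * ∑ i, r i ^ 2 ≤ 8 * δ := by
      have h2 : ∑ i, r i ^ 2 ≤ 2 * (∑ i, (s i : ℝ) ^ 2 - ∑ i, (s i : ℝ)) := by
        rw [← sum_sub_distrib, mul_sum]
        exact sum_le_sum fun i _ => hr2 i
      have h3 := hsq (∑ i, s i)
      push_cast at h1 h3
      have h4 := mul_nonneg hR0 h3
      have h5 := mul_le_mul_of_nonneg_right hqR (sub_nonneg.2 hQ)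
      have h6 := mul_le_mul_of_nonneg_left h2 hq0
      nlinarith
    have hr0 : 0 ≤ ∑ i, r i ^ 2 := sum_nonneg fun i _ => sq_nonneg _
    have hEr : sliceExp n k (fun T => (∑ i ∈ T, r i) ^ 2) ≤ 10 * δ := by
      rw [sliceExp_linear_sq hkn']
      have h2 := pair_density_le_sq (by linarith : (1 : ℝ) < n) (by positivity)
        (by linarith : (k : ℝ) ≤ n)
      have h3 : (∑ i, r i) ^ 2 ≤ (∑ i, r i ^ 2) ^ 2 := by
        rw [sq_le_sq, abs_of_nonneg hr0]
        exact (abs_sum_le_sum_abs _ _).trans (sum_le_sum fun i _ => hrabs i)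
      have h4 := mul_le_mul h2 h3 (sq_nonneg _) (sq_nonneg _)
      rw [← mul_pow] at h4
      have h5 : (k / n * ∑ i, r i ^ 2) ^ 2 ≤ 8 * δ * (8 * δ) := by
        rw [sq]
        exact mul_le_mul hsum hsum (by positivity) (by positivity)
      nlinarith [mul_nonneg hR0 hr0]
    have hclose : sliceExp n k (fun T => (f T - ((S ∩ T).card : ℤ)) ^ 2) ≤ 22 * δ := by
      refine (sliceExp_sq_sub_le h (b := 10 * δ) ?_).trans (by linarith)
      refine (le_of_eq (sliceExp_congr fun T _ => ?_)).trans hEr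
      have : ((S ∩ T).card : ℝ) = ∑ i ∈ T, if i ∈ S then (1 : ℝ) else 0 := by
        simp [inter_comm]
      push_cast
      rw [this]
      simp only [hr, sum_sub_distrib]
      ring
    obtain ⟨h2, h3⟩ := close_to_maxInd_of_close_to_card hk (by omega) hf S hclose
    exact ⟨S, h2.imp_right fun h => h.trans (by linarith), Or.inl (h3.trans (by linarith))⟩
  · refine ⟨∅, Or.inl (by simp), Or.inr ?_⟩
    have h2 : sliceExp n k (fun T => (((1 + ∑ i ∈ T, s i : ℤ) : ℝ) - 1) ^ 2) ≤ 2 * δ := by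
      have : sliceExp n k (fun T => (((1 + ∑ i ∈ T, s i : ℤ) : ℝ) - 1) ^ 2)
          = sliceExp n k (fun T => (∑ i ∈ T, (s i : ℝ)) ^ 2) :=
        sliceExp_congr fun T _ => by push_cast; ring
      rw [this, sliceExp_linear_sq hkn']
      push_cast at h1
      nlinarith [mul_nonneg hq0 hAR]
    refine le_trans (le_of_eq (sliceExp_congr fun T _ => ?_))
      ((sliceExp_sq_sub_le h h2).trans (by linarith))
    simp [maxInd]
    ring

lemma exists_maxInd_of_int_coeff {n k : ℕ} (hk : 2 ≤ k) (hkn : 2 * k ≤ n)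
    {f : Finset (Fin n) → ℝ} (hf : ∀ T ∈ theSlice n k, f T = 0 ∨ f T = 1)
    {B : ℤ} {s : Fin n → ℤ} {δ : ℝ} (hδ : δ ≤ 1 / 400)
    (h : sliceExp n k (fun T => (f T - (B + ∑ i ∈ T, s i : ℤ)) ^ 2) ≤ δ) :
    ∃ S : Finset (Fin n), (S.card ≤ 1 ∨ ((k / n : ℝ) * S.card) ^ 2 ≤ 176 * δ) ∧
      (sliceExp n k (fun T => (f T - maxInd S T) ^ 2) ≤ 132 * δ ∨
        sliceExp n k (fun T => ((1 - f T) - maxInd S T) ^ 2) ≤ 132 * δ) := by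
  have hn0 : (0 : ℝ) < n := by exact_mod_cast (by omega : 0 < n)
  set r : ℤ := round ((∑ i, s i : ℤ) / (n : ℝ)) with hr
  set s' : Fin n → ℤ := fun i => s i - r with hs'
  have hs'sum : ∑ i, s' i = ∑ i, s i - n * r := by simp [hs']
  have habs : |2 * ∑ i, s' i| ≤ n := by
    have h1 := abs_sub_round ((∑ i, s i : ℤ) / (n : ℝ))
    rw [← hr] at h1
    have h2 : |(2 * ∑ i, s' i : ℤ)| = 2 * n * |((∑ i, s i : ℤ) / (n : ℝ)) - r| := by
      rw [← abs_of_pos (by positivity : (0 : ℝ) < 2 * n), ← abs_mul, hs'sum, Int.cast_abs]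
      congr 1
      push_cast
      field_simp
    have h3 : (|(2 * ∑ i, s' i : ℤ)| : ℝ) ≤ n := by
      rw [Int.cast_abs] at h2
      rw [h2]; nlinarith
    exact_mod_cast h3
  obtain ⟨hlo, hhi⟩ := abs_le.1 habs
  have h' : sliceExp n k (fun T => (f T - ((B + k * r) + ∑ i ∈ T, s' i : ℤ)) ^ 2) ≤ δ := by
    refine (le_of_eq (sliceExp_congr fun T hT => ?_)).trans h
    simp only [hs', sum_sub_distrib, sum_const, mem_theSlice.1 hT, nsmul_eq_mul]
    push_cast
    ring
  rcases le_total 0 (∑ i, s' i) with hA | hA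
  · exact exists_maxInd_of_int_coeff_of_nonneg hk hkn hf hδ h' hA hhi
  · have hf' : ∀ T ∈ theSlice n k, 1 - f T = 0 ∨ 1 - f T = 1 := fun T hT => by
      rcases hf T hT with h | h <;> simp [h]
    have h'' : sliceExp n k (fun T => ((1 - f T) - ((1 - (B + k * r)) + ∑ i ∈ T, -s' i : ℤ)) ^ 2)
        ≤ δ := by
      refine (le_of_eq (sliceExp_congr fun T hT => ?_)).trans h'
      rw [sum_neg_distrib]
      push_cast
      ring
    obtain ⟨S, h1, h2⟩ := exists_maxInd_of_int_coeff_of_nonneg hk hkn hf' hδ h''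
      (by rw [sum_neg_distrib]; omega) (by rw [sum_neg_distrib]; omega)
    refine ⟨S, h1, h2.symm.imp_left fun h => ?_⟩
    simpa using h

/-! ### The theorem -/

lemma exists_maxInd_of_close_to_affine {n k : ℕ} (hk : 2 ≤ k) (hkn : 2 * k ≤ n)
    {f : Finset (Fin n) → ℝ} (hf : ∀ T ∈ theSlice n k, f T = 0 ∨ f T = 1)
    {b : ℝ} {c : Fin n → ℝ} {ε : ℝ}
    (h : sliceExp n k (fun T => (f T - (b + ∑ i ∈ T, c i)) ^ 2) ≤ ε) :
    ∃ S : Finset (Fin n),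
      (S.card : ℝ) ≤ max 1 (10 ^ 6 * Real.sqrt ε / (k / n)) ∧
      (sliceExp n k (fun T => (f T - maxInd S T) ^ 2) ≤ 10 ^ 6 * ε ∨
        sliceExp n k (fun T => ((1 - f T) - maxInd S T) ^ 2) ≤ 10 ^ 6 * ε) := by
  have hkn' : k ≤ n := by omega
  have hε : 0 ≤ ε := by
    refine le_trans ?_ h
    rw [← sliceExp_const hkn' (0 : ℝ)]
    exact sliceExp_mono fun T _ => sq_nonneg _
  rcases le_or_gt (712 * ε) (1 / 400) with hsmall | hlarge
  · obtain ⟨B, s, hs⟩ := exists_int_coeff hk hkn hf h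
    obtain ⟨S, h1, h2⟩ := exists_maxInd_of_int_coeff hk hkn hf hsmall hs
    refine ⟨S, ?_, h2.imp (fun h => h.trans (by linarith)) (fun h => h.trans (by linarith))⟩
    rcases h1 with h1 | h1
    · exact le_max_of_le_left (by exact_mod_cast h1)
    · refine le_max_of_le_right ?_
      have hq : (0 : ℝ) < k / n := by
        have : 0 < k := by omega
        have : 0 < n := by omega
        positivity
      rw [le_div_iff₀ hq, mul_comm]
      refine le_of_sq_le_sq (h1.trans ?_) (by positivity)
      rw [mul_pow, Real.sq_sqrt hε]
      linarith
  · refine ⟨∅, le_max_of_le_left (by simp), Or.inl ?_⟩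
    calc sliceExp n k (fun T => (f T - maxInd ∅ T) ^ 2) ≤ sliceExp n k (fun _ => 1) := by
          refine sliceExp_mono fun T hT => ?_
          rcases hf T hT with h | h <;> simp [maxInd, h]
      _ = 1 := sliceExp_const hkn' 1
      _ ≤ 10 ^ 6 * ε := by linarith

lemma sliceExp_compl {n k : ℕ} (hk : k ≤ n) (g : Finset (Fin n) → ℝ) :
    sliceExp n (n - k) (fun T => g Tᶜ) = sliceExp n k g := by
  unfold sliceExp
  rw [Nat.choose_symm hk]
  congr 1
  refine sum_nbij' compl compl (fun T hT => ?_) (fun T hT => ?_) (by simp) (by simp) (by simp)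
  · rw [mem_theSlice] at hT ⊢
    rw [card_compl, hT, Fintype.card_fin]
    omega
  · rw [mem_theSlice] at hT ⊢
    rw [card_compl, hT, Fintype.card_fin]

lemma maxInd_compl {n : ℕ} (S T : Finset (Fin n)) : maxInd S Tᶜ = 1 - minInd S T := by
  have : (S ∩ Tᶜ).Nonempty ↔ ¬ S ⊆ T := by
    rw [← sdiff_eq_inter_compl, sdiff_nonempty]
  unfold maxInd minInd
  by_cases h : S ⊆ T <;> simp [this, h]

/-- the FKN theorem for the slice (main theorem). There is an absolute
constant `C` such that for `2 ≤ k ≤ n-2` and `p = min(k/n, 1-k/n)`, if a Boolean `f`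
on the slice is `ε`-close to an affine function, then `f` or `1-f` is `Cε`-close to
`max_{i∈S} x_i` (when `k/n ≤ 1/2`) or `min_{i∈S} x_i` (when `k/n ≥ 1/2`) for some
`S` with `|S| ≤ max(1, C√ε/p)`. -/
theorem fkn_slice :
    ∃ C > (0 : ℝ), ∀ (n k : ℕ) (f : Finset (Fin n) → ℝ) (c : Fin n → ℝ) (ε : ℝ),
      2 ≤ k → k + 2 ≤ n →
      (∀ T ∈ theSlice n k, f T = 0 ∨ f T = 1) →
      sliceExp n k (fun T => (f T - ∑ i ∈ T, c i) ^ 2) ≤ ε →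
      ∃ S : Finset (Fin n),
        (S.card : ℝ) ≤
          max 1 (C * Real.sqrt ε / min ((k : ℝ) / n) (1 - (k : ℝ) / n)) ∧
        ∃ g : Finset (Fin n) → ℝ,
          ((2 * k ≤ n ∧ g = maxInd S) ∨ (n ≤ 2 * k ∧ g = minInd S)) ∧
          (sliceExp n k (fun T => (f T - g T) ^ 2) ≤ C * ε ∨
           sliceExp n k (fun T => ((1 - f T) - g T) ^ 2) ≤ C * ε) := by
  refine ⟨10 ^ 6, by norm_num, fun n k f c ε hk hkn hf h => ?_⟩
  have hn0 : (0 : ℝ) < n := by exact_mod_cast (by omega : 0 < n)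
  rcases le_total (2 * k) n with hle | hle
  · have hmin : min ((k : ℝ) / n) (1 - k / n) = k / n := by
      have : (2 * k : ℝ) ≤ n := by exact_mod_cast hle
      rw [min_eq_left_iff, le_sub_iff_add_le, ← add_div, div_le_one hn0]
      linarith
    obtain ⟨S, h1, h2⟩ := exists_maxInd_of_close_to_affine hk hle hf (b := 0) (by simpa using h)
    exact ⟨S, by rwa [hmin], maxInd S, Or.inl ⟨hle, rfl⟩, h2⟩
  · have hkn' : k ≤ n := by omega
    have hsub : ((n - k : ℕ) : ℝ) / n = 1 - k / n := by
      rw [Nat.cast_sub hkn']; field_simp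
    have hmin : min ((k : ℝ) / n) (1 - k / n) = ((n - k : ℕ) : ℝ) / n := by
      have : (n : ℝ) ≤ 2 * k := by exact_mod_cast hle
      rw [hsub, min_eq_right_iff, sub_le_iff_le_add, ← add_div, one_le_div hn0]
      linarith
    have hf' : ∀ T ∈ theSlice n (n - k), f Tᶜ = 0 ∨ f Tᶜ = 1 := fun T hT => hf _ <| by
      rw [mem_theSlice] at hT ⊢
      rw [card_compl, hT, Fintype.card_fin]
      omega
    have h' : sliceExp n (n - k) (fun T => (f Tᶜ - (∑ i, c i + ∑ i ∈ T, -c i)) ^ 2) ≤ ε := by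
      rw [← sliceExp_compl hkn'] at h
      refine (le_of_eq (sliceExp_congr fun T _ => ?_)).trans h
      rw [← sum_add_sum_compl T c, sum_neg_distrib]
      ring
    obtain ⟨S, h1, h2⟩ := exists_maxInd_of_close_to_affine (by omega) (by omega) hf' h'
    refine ⟨S, by rwa [hmin], minInd S, Or.inr ⟨hle, rfl⟩, ?_⟩
    refine h2.symm.imp (fun h => ?_) (fun h => ?_) <;>
    · rw [← sliceExp_compl hkn']
      refine (le_of_eq (sliceExp_congr fun T _ => ?_)).trans h
      have := maxInd_compl S Tᶜ
      rw [compl_compl] at this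
      rw [this]
      ring
end

section
/- Let $p \in (0,1)$ and suppose $f\colon \{0,1\}^n \to \{0,1\}$ is $\epsilon$-close (squared $L_2$ with respect to the product measure $\mu_p$) to an affine function $c_0 + \sum_i c_i x_i$. Then there is an absolute constant $C$ (independent of $p$ and $n$) such that either $f$ or $1-f$ is $C\epsilon$-close under $\mu_p$ to $\max_{i\in S} x_i$ (if $p \le 1/2$) or to $\min_{i\in S} x_i$ (if $p > 1/2$) for some set $S$ with $|S| \le \max(1, C\sqrt{\epsilon}/\min(p, 1-p))$. -/
/-- The weight of a point of the cube under the biased product measure `μ_p`. -/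
noncomputable def muP (n : ℕ) (p : ℝ) (x : Fin n → Bool) : ℝ :=
  p ^ (Finset.univ.filter (fun i => x i = true)).card *
    (1 - p) ^ (Finset.univ.filter (fun i => x i = false)).card

/-- Expectation with respect to `μ_p`. -/
noncomputable def muPExp (n : ℕ) (p : ℝ) (h : (Fin n → Bool) → ℝ) : ℝ :=
  ∑ x : Fin n → Bool, muP n p x * h x

/-- `max_{i ∈ S} x_i` on the cube (with `max_∅ = 0`). -/
def cubeMax {n : ℕ} (S : Finset (Fin n)) (x : Fin n → Bool) : ℝ :=
  if ∃ i ∈ S, x i = true then 1 else 0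

/-- `min_{i ∈ S} x_i` on the cube (with `min_∅ = 1`). -/
def cubeMin {n : ℕ} (S : Finset (Fin n)) (x : Fin n → Bool) : ℝ :=
  if ∀ i ∈ S, x i = true then 1 else 0

namespace BiasedCube

lemma muP_eq_prod (n : ℕ) (p : ℝ) (x : Fin n → Bool) :
    muP n p x = ∏ i, (if x i then p else 1 - p) := by
  simp [muP, Finset.prod_ite, Finset.prod_const]

lemma muP_nonneg {n : ℕ} {p : ℝ} (h0 : 0 ≤ p) (h1 : p ≤ 1) (x : Fin n → Bool) :
    0 ≤ muP n p x :=
  mul_nonneg (pow_nonneg h0 _) (pow_nonneg (by linarith) _)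

lemma muPExp_zero (p : ℝ) (h : (Fin 0 → Bool) → ℝ) : muPExp 0 p h = h default := by
  rw [muPExp, Fintype.sum_eq_single default fun x hx => absurd (Subsingleton.elim _ _) hx]
  simp [muP]

/-- Condition on the first coordinate. -/
lemma muPExp_succ (n : ℕ) (p : ℝ) (h : (Fin (n + 1) → Bool) → ℝ) :
    muPExp (n + 1) p h =
      p * muPExp n p (fun x => h (Fin.cons true x)) +
        (1 - p) * muPExp n p (fun x => h (Fin.cons false x)) := by
  unfold muPExp
  rw [← (Fin.consEquiv (fun _ : Fin (n + 1) => Bool)).sum_comp, Fintype.sum_prod_type]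
  simp only [Fintype.sum_bool, Finset.mul_sum, Fin.consEquiv, Equiv.coe_fn_mk, muP_eq_prod,
    Fin.prod_univ_succ, Fin.cons_zero, Fin.cons_succ]
  simp [mul_assoc]

lemma muPExp_add (n : ℕ) (p : ℝ) (g h : (Fin n → Bool) → ℝ) :
    muPExp n p (fun x => g x + h x) = muPExp n p g + muPExp n p h := by
  simp [muPExp, mul_add, Finset.sum_add_distrib]

lemma muPExp_sub (n : ℕ) (p : ℝ) (g h : (Fin n → Bool) → ℝ) :
    muPExp n p (fun x => g x - h x) = muPExp n p g - muPExp n p h := by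
  simp [muPExp, mul_sub, Finset.sum_sub_distrib]

lemma muPExp_const_mul (n : ℕ) (p a : ℝ) (h : (Fin n → Bool) → ℝ) :
    muPExp n p (fun x => a * h x) = a * muPExp n p h := by
  simp only [muPExp, Finset.mul_sum]
  exact Finset.sum_congr rfl fun x _ => by ring

lemma muPExp_const (n : ℕ) (p a : ℝ) : muPExp n p (fun _ => a) = a := by
  induction n with
  | zero => rw [muPExp_zero]
  | succ n ih => rw [muPExp_succ, ih]; ring

lemma muPExp_mono {n : ℕ} {p : ℝ} (h0 : 0 ≤ p) (h1 : p ≤ 1) {g h : (Fin n → Bool) → ℝ}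
    (hgh : ∀ x, g x ≤ h x) : muPExp n p g ≤ muPExp n p h :=
  Finset.sum_le_sum fun x _ => mul_le_mul_of_nonneg_left (hgh x) (muP_nonneg h0 h1 x)

lemma muPExp_nonneg {n : ℕ} {p : ℝ} (h0 : 0 ≤ p) (h1 : p ≤ 1) {h : (Fin n → Bool) → ℝ}
    (hh : ∀ x, 0 ≤ h x) : 0 ≤ muPExp n p h :=
  Finset.sum_nonneg fun x _ => mul_nonneg (muP_nonneg h0 h1 x) (hh x)

lemma muPExp_sum {ι : Type*} (s : Finset ι) (n : ℕ) (p : ℝ) (h : ι → (Fin n → Bool) → ℝ) :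
    muPExp n p (fun x => ∑ i ∈ s, h i x) = ∑ i ∈ s, muPExp n p (h i) := by
  simp only [muPExp, Finset.mul_sum]
  exact Finset.sum_comm

/-- Cauchy–Schwarz for `μ_p`. -/
lemma muPExp_mul_sq_le {n : ℕ} {p : ℝ} (h0 : 0 ≤ p) (h1 : p ≤ 1) (g h : (Fin n → Bool) → ℝ) :
    muPExp n p (fun x => g x * h x) ^ 2 ≤
      muPExp n p (fun x => g x ^ 2) * muPExp n p (fun x => h x ^ 2) := by
  refine Finset.sum_sq_le_sum_mul_sum_of_sq_le_mul _ (fun x _ => ?_) (fun x _ => ?_)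
    (fun x _ => ?_)
  · exact mul_nonneg (muP_nonneg h0 h1 x) (sq_nonneg _)
  · exact mul_nonneg (muP_nonneg h0 h1 x) (sq_nonneg _)
  · exact le_of_eq (by ring)

/-- The expectation of a product of functions of distinct coordinates. -/
lemma muPExp_prod (n : ℕ) (p : ℝ) (g : Fin n → Bool → ℝ) :
    muPExp n p (fun x => ∏ i, g i (x i)) = ∏ i, (p * g i true + (1 - p) * g i false) := by
  induction n with
  | zero => simp [muPExp_zero]
  | succ n ih =>
    simp only [muPExp_succ, Fin.prod_univ_succ, Fin.cons_zero, Fin.cons_succ, muPExp_const_mul, ih]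
    ring

/-- Flipping all the coordinates exchanges `μ_p` and `μ_{1-p}`. -/
lemma muPExp_not (n : ℕ) (p : ℝ) (h : (Fin n → Bool) → ℝ) :
    muPExp n (1 - p) (fun x => h (fun i => !x i)) = muPExp n p h := by
  induction n with
  | zero => simp only [muPExp_zero]; exact congrArg h (Subsingleton.elim _ _)
  | succ n ih =>
    have key (b : Bool) (x : Fin n → Bool) :
        (fun i => !(Fin.cons b x : Fin (n + 1) → Bool) i) = Fin.cons (!b) (fun i => !x i) := by
      funext i
      refine Fin.cases ?_ (fun i => ?_) i <;> simp
    simp only [muPExp_succ, key]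
    rw [ih (fun x => h (Fin.cons (!true) x)), ih (fun x => h (Fin.cons (!false) x))]
    simp only [Bool.not_true, Bool.not_false]
    ring

/-- The coordinatewise conjunction of independent samples of `μ_q` and `μ_r` is distributed
as `μ_{qr}`. -/
lemma muPExp_and (n : ℕ) (q r : ℝ) (h : (Fin n → Bool) → ℝ) :
    muPExp n q (fun z => muPExp n r (fun y => h (fun i => z i && y i))) = muPExp n (q * r) h := by
  induction n with
  | zero => simp only [muPExp_zero]; exact congrArg h (Subsingleton.elim _ _)
  | succ n ih =>
    have key (b b' : Bool) (x y : Fin n → Bool) :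
        (fun i => (Fin.cons b x : Fin (n + 1) → Bool) i &&
          (Fin.cons b' y : Fin (n + 1) → Bool) i) = Fin.cons (b && b') (fun i => x i && y i) := by
      funext i
      refine Fin.cases ?_ (fun i => ?_) i <;> simp
    simp only [muPExp_succ, key, muPExp_add, muPExp_const_mul]
    simp only [fun b => ih (fun x => h (Fin.cons b x))]
    simp only [Bool.and_true, Bool.and_false]
    ring

/-- The centred affine forms have variance `p (1 - p) ∑ dᵢ²`. -/
lemma muPExp_centered_sq (n : ℕ) (p : ℝ) (d : Fin n → ℝ) :
    muPExp n p (fun x => (∑ i, d i * ((if x i then 1 else 0) - p)) ^ 2) =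
      p * (1 - p) * ∑ i, d i ^ 2 := by
  induction n with
  | zero => simp [muPExp_zero]
  | succ n ih =>
    simp only [muPExp_succ, Fin.sum_univ_succ, Fin.cons_zero, Fin.cons_succ]
    rw [← muPExp_const_mul, ← muPExp_const_mul, ← muPExp_add, mul_add, ← ih (fun i => d i.succ),
      ← muPExp_const n p (p * (1 - p) * d 0 ^ 2), ← muPExp_add]
    congr 1
    funext x
    simp only [if_true, Bool.false_eq_true, if_false]
    ring

/-- The affine form `a₀ + ∑ ±aᵢ`, the signs being given by a point of the cube. -/
noncomputable def signForm {n : ℕ} (a₀ : ℝ) (a : Fin n → ℝ) (x : Fin n → Bool) : ℝ :=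
  a₀ + ∑ i, (if x i then a i else -a i)

/-- The sum of the squares of the coefficients of an affine form. -/
noncomputable def energy {n : ℕ} (a₀ : ℝ) (a : Fin n → ℝ) : ℝ := a₀ ^ 2 + ∑ i, a i ^ 2

lemma energy_nonneg {n : ℕ} (a₀ : ℝ) (a : Fin n → ℝ) : 0 ≤ energy a₀ a := by
  unfold energy; positivity

lemma signForm_cons_true {n : ℕ} (a₀ : ℝ) (a : Fin (n + 1) → ℝ) (x : Fin n → Bool) :
    signForm a₀ a (Fin.cons true x) = signForm a₀ (fun i => a i.succ) x + a 0 := by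
  simp only [signForm, Fin.sum_univ_succ, Fin.cons_zero, Fin.cons_succ, if_true]; ring

lemma signForm_cons_false {n : ℕ} (a₀ : ℝ) (a : Fin (n + 1) → ℝ) (x : Fin n → Bool) :
    signForm a₀ a (Fin.cons false x) = signForm a₀ (fun i => a i.succ) x - a 0 := by
  simp only [signForm, Fin.sum_univ_succ, Fin.cons_zero, Fin.cons_succ, Bool.false_eq_true,
    if_false]
  ring

lemma energy_succ {n : ℕ} (a₀ : ℝ) (a : Fin (n + 1) → ℝ) :
    energy a₀ a = energy a₀ (fun i => a i.succ) + a 0 ^ 2 := by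
  simp only [energy, Fin.sum_univ_succ]; ring

/-- Averaging over the first coordinate, for the uniform measure. -/
lemma muPExp_half_succ (n : ℕ) (h : (Fin (n + 1) → Bool) → ℝ) :
    muPExp (n + 1) (1 / 2) h =
      muPExp n (1 / 2) (fun x => (h (Fin.cons true x) + h (Fin.cons false x)) / 2) := by
  rw [muPExp_succ, ← muPExp_const_mul, ← muPExp_const_mul, ← muPExp_add]
  congr 1
  funext x
  ring

lemma muPExp_signForm_sq {n : ℕ} (a₀ : ℝ) (a : Fin n → ℝ) :
    muPExp n (1 / 2) (fun x => signForm a₀ a x ^ 2) = energy a₀ a := by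
  induction n with
  | zero => simp [muPExp_zero, signForm, energy]
  | succ n ih =>
    rw [muPExp_half_succ, energy_succ, ← ih, ← muPExp_const n (1 / 2) (a 0 ^ 2), ← muPExp_add]
    congr 1
    funext x
    rw [signForm_cons_true, signForm_cons_false]
    ring

lemma muPExp_signForm_pow_four_le {n : ℕ} (a₀ : ℝ) (a : Fin n → ℝ) :
    muPExp n (1 / 2) (fun x => signForm a₀ a x ^ 4) ≤ 3 * energy a₀ a ^ 2 := by
  induction n with
  | zero =>
    simp only [muPExp_zero, signForm, energy, Finset.univ_eq_empty, Finset.sum_empty]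
    nlinarith [sq_nonneg (a₀ ^ 2)]
  | succ n ih =>
    have h : muPExp (n + 1) (1 / 2) (fun x => signForm a₀ a x ^ 4) =
        muPExp n (1 / 2) (fun x => signForm a₀ (fun i => a i.succ) x ^ 4) +
          6 * a 0 ^ 2 * energy a₀ (fun i => a i.succ) + a 0 ^ 4 := by
      rw [muPExp_half_succ, ← muPExp_signForm_sq, ← muPExp_const_mul, ← muPExp_add,
        ← muPExp_const n (1 / 2) (a 0 ^ 4), ← muPExp_add]
      congr 1
      funext x
      rw [signForm_cons_true, signForm_cons_false]
      ring
    rw [h, energy_succ]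
    nlinarith [ih (fun i => a i.succ), sq_nonneg (a 0 ^ 2)]

/-- The square of an affine form, minus its mean. -/
noncomputable def signQuad {n : ℕ} (a₀ : ℝ) (a : Fin n → ℝ) (x : Fin n → Bool) : ℝ :=
  signForm a₀ a x ^ 2 - energy a₀ a

lemma signQuad_cons_true {n : ℕ} (a₀ : ℝ) (a : Fin (n + 1) → ℝ) (x : Fin n → Bool) :
    signQuad a₀ a (Fin.cons true x) = signQuad a₀ (fun i => a i.succ) x +
      2 * a 0 * signForm a₀ (fun i => a i.succ) x := by
  simp only [signQuad, signForm_cons_true, energy_succ]; ring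

lemma signQuad_cons_false {n : ℕ} (a₀ : ℝ) (a : Fin (n + 1) → ℝ) (x : Fin n → Bool) :
    signQuad a₀ a (Fin.cons false x) = signQuad a₀ (fun i => a i.succ) x -
      2 * a 0 * signForm a₀ (fun i => a i.succ) x := by
  simp only [signQuad, signForm_cons_false, energy_succ]; ring

lemma muPExp_signQuad_sq_succ {n : ℕ} (a₀ : ℝ) (a : Fin (n + 1) → ℝ) :
    muPExp (n + 1) (1 / 2) (fun x => signQuad a₀ a x ^ 2) =
      muPExp n (1 / 2) (fun x => signQuad a₀ (fun i => a i.succ) x ^ 2) +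
        4 * a 0 ^ 2 * energy a₀ (fun i => a i.succ) := by
  rw [muPExp_half_succ, ← muPExp_signForm_sq, ← muPExp_const_mul, ← muPExp_add]
  congr 1
  funext x
  rw [signQuad_cons_true, signQuad_cons_false]
  ring

lemma muPExp_signQuad_sq {n : ℕ} (a₀ : ℝ) (a : Fin n → ℝ) :
    muPExp n (1 / 2) (fun x => signQuad a₀ a x ^ 2) =
      2 * (energy a₀ a ^ 2 - (a₀ ^ 4 + ∑ i, a i ^ 4)) := by
  induction n with
  | zero => simp [muPExp_zero, signQuad, signForm, energy]; ring
  | succ n ih =>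
    rw [muPExp_signQuad_sq_succ, ih, energy_succ, Fin.sum_univ_succ]
    ring

/-- Hypercontractivity for the quadratic part of the square of an affine form. -/
lemma muPExp_signQuad_pow_four_le {n : ℕ} (a₀ : ℝ) (a : Fin n → ℝ) :
    muPExp n (1 / 2) (fun x => signQuad a₀ a x ^ 4) ≤
      81 * muPExp n (1 / 2) (fun x => signQuad a₀ a x ^ 2) ^ 2 := by
  induction n with
  | zero => simp [muPExp_zero, signQuad, signForm, energy]
  | succ n ih =>
    set b : Fin n → ℝ := fun i => a i.succ with hb
    set V := muPExp n (1 / 2) (fun x => signQuad a₀ b x ^ 2) with hV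
    set X := muPExp n (1 / 2) (fun x => signQuad a₀ b x ^ 2 * signForm a₀ b x ^ 2) with hX
    have hrec : muPExp (n + 1) (1 / 2) (fun x => signQuad a₀ a x ^ 4) =
        muPExp n (1 / 2) (fun x => signQuad a₀ b x ^ 4) + 24 * a 0 ^ 2 * X +
          16 * a 0 ^ 4 * muPExp n (1 / 2) (fun x => signForm a₀ b x ^ 4) := by
      rw [muPExp_half_succ, hX, ← muPExp_const_mul, ← muPExp_const_mul, ← muPExp_add,
        ← muPExp_add]
      congr 1
      funext x
      rw [signQuad_cons_true, signQuad_cons_false]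
      ring
    have hs := energy_nonneg a₀ b
    have hV0 : 0 ≤ V := muPExp_nonneg (by norm_num) (by norm_num) fun x => sq_nonneg _
    have h4 := ih b
    have hL := muPExp_signForm_pow_four_le a₀ b
    have hX2 : X ≤ 16 * V * energy a₀ b := by
      have hcs := muPExp_mul_sq_le (p := 1 / 2) (by norm_num) (by norm_num)
        (fun x => signQuad a₀ b x ^ 2) (fun x => signForm a₀ b x ^ 2)
      simp only [← pow_mul, Nat.reduceMul] at hcs
      refine abs_le_of_sq_le_sq' ?_ (by positivity) |>.2
      calc X ^ 2 ≤ _ := hcs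
        _ ≤ (81 * V ^ 2) * (3 * energy a₀ b ^ 2) := by
          refine mul_le_mul h4 hL ?_ (by positivity)
          exact muPExp_nonneg (by norm_num) (by norm_num) fun x => by positivity
        _ ≤ (16 * V * energy a₀ b) ^ 2 := by nlinarith [sq_nonneg (V * energy a₀ b)]
    rw [hrec, muPExp_signQuad_sq_succ]
    have e1 : 24 * a 0 ^ 2 * X ≤ 24 * a 0 ^ 2 * (16 * V * energy a₀ b) := by gcongr
    have e2 : 16 * a 0 ^ 4 * muPExp n (1 / 2) (fun x => signForm a₀ b x ^ 4) ≤
        16 * a 0 ^ 4 * (3 * energy a₀ b ^ 2) := by gcongr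
    have e3 : 0 ≤ a 0 ^ 2 * V * energy a₀ b := by positivity
    have e4 : 0 ≤ a 0 ^ 4 * energy a₀ b ^ 2 := by positivity
    nlinarith

/-- The second moment of the quadratic part is controlled by its first moment. -/
lemma muPExp_signQuad_sq_le_abs {n : ℕ} (a₀ : ℝ) (a : Fin n → ℝ) :
    muPExp n (1 / 2) (fun x => signQuad a₀ a x ^ 2) ≤
      648 * muPExp n (1 / 2) (fun x => |signQuad a₀ a x|) ^ 2 := by
  set V := muPExp n (1 / 2) (fun x => signQuad a₀ a x ^ 2) with hV
  set A := muPExp n (1 / 2) (fun x => |signQuad a₀ a x|) with hA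
  have hV0 : 0 ≤ V := muPExp_nonneg (by norm_num) (by norm_num) fun x => sq_nonneg _
  rcases hV0.eq_or_lt with h0 | hpos
  · rw [← h0]; positivity
  set t := √(162 * V) with ht
  have ht2 : t ^ 2 = 162 * V := Real.sq_sqrt (by positivity)
  have htpos : 0 < t := Real.sqrt_pos.2 (by positivity)
  have hpt : ∀ x, t ^ 2 * signQuad a₀ a x ^ 2 ≤
      t ^ 3 * |signQuad a₀ a x| + signQuad a₀ a x ^ 4 := by
    intro x
    have hq := abs_nonneg (signQuad a₀ a x)
    rw [← sq_abs (signQuad a₀ a x), ← Even.pow_abs (n := 4) (by decide) (signQuad a₀ a x)]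
    generalize |signQuad a₀ a x| = q at hq
    rcases le_total q t with h | h
    · have : t ^ 2 * q * q ≤ t ^ 2 * q * t := by gcongr
      have : 0 ≤ q ^ 4 := by positivity
      nlinarith
    · have : t ^ 2 * q ^ 2 ≤ q ^ 2 * q ^ 2 := by gcongr
      have : 0 ≤ t ^ 3 * q := by positivity
      nlinarith
  have hint := muPExp_mono (p := 1 / 2) (by norm_num) (by norm_num) hpt
  rw [muPExp_add, muPExp_const_mul, muPExp_const_mul] at hint
  have h4 := muPExp_signQuad_pow_four_le a₀ a
  rw [← hV] at h4 hint
  rw [← hA] at hint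
  have h5 : t ^ 2 * V ≤ t ^ 2 * (2 * t * A) := by
    have : t ^ 2 * V = 162 * V ^ 2 := by rw [ht2]; ring
    nlinarith
  have h6 : V ≤ 2 * t * A := le_of_mul_le_mul_left h5 (by positivity)
  have h7 : V ^ 2 ≤ (2 * t * A) ^ 2 := by gcongr
  have h8 : V * V ≤ V * (648 * A ^ 2) := by
    have : (2 * t * A) ^ 2 = 4 * t ^ 2 * A ^ 2 := by ring
    rw [this, ht2] at h7
    nlinarith
  exact le_of_mul_le_mul_left h8 hpos

/-- The coefficients of an affine form, the constant one being indexed by `none`. -/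
noncomputable def coeff {n : ℕ} (a₀ : ℝ) (a : Fin n → ℝ) (o : Option (Fin n)) : ℝ := o.elim a₀ a

lemma sum_coeff_pow {n : ℕ} (a₀ : ℝ) (a : Fin n → ℝ) (k : ℕ) :
    ∑ o, coeff a₀ a o ^ k = a₀ ^ k + ∑ i, a i ^ k := by
  simp [coeff, Fintype.sum_option]

/-- The Friedgut–Kalai–Naor theorem for the uniform measure: an affine form close to `±1` is
dominated by a single coefficient. -/
lemma exists_dominant_coeff {n : ℕ} (a₀ : ℝ) (a : Fin n → ℝ) {δ : ℝ}
    (h : muPExp n (1 / 2) (fun x => (|signForm a₀ a x| - 1) ^ 2) ≤ δ) :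
    ∃ o, energy a₀ a - coeff a₀ a o ^ 2 + (|coeff a₀ a o| - 1) ^ 2 ≤ 160000 * δ := by
  have hE : energy a₀ a ≤ 2 * δ + 2 := by
    have := muPExp_mono (n := n) (p := 1 / 2) (by norm_num) (by norm_num)
      (g := fun x => signForm a₀ a x ^ 2)
      (h := fun x => 2 * (|signForm a₀ a x| - 1) ^ 2 + 2) (fun x => by
        rw [← sq_abs (signForm a₀ a x)]
        nlinarith [sq_nonneg (|signForm a₀ a x| - 2)])
    rw [muPExp_signForm_sq, muPExp_add, muPExp_const_mul, muPExp_const] at this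
    linarith
  have hδ0 : 0 ≤ δ :=
    (muPExp_nonneg (by norm_num) (by norm_num) fun x => sq_nonneg _).trans h
  obtain ⟨o, -, ho⟩ := Finset.exists_max_image Finset.univ (fun o => coeff a₀ a o ^ 2)
    ⟨none, Finset.mem_univ _⟩
  refine ⟨o, ?_⟩
  set s := energy a₀ a with hs
  have hs0 : 0 ≤ s := energy_nonneg a₀ a
  have hsM : coeff a₀ a o ^ 2 ≤ s := by
    rw [hs, energy, ← sum_coeff_pow]
    exact Finset.single_le_sum (f := fun o => coeff a₀ a o ^ 2) (fun _ _ => sq_nonneg _)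
      (Finset.mem_univ o)
  have hfour : a₀ ^ 4 + ∑ i, a i ^ 4 ≤ coeff a₀ a o ^ 2 * s := by
    rw [hs, energy, ← sum_coeff_pow, ← sum_coeff_pow, Finset.mul_sum]
    refine Finset.sum_le_sum fun j hj => ?_
    nlinarith [ho j hj, sq_nonneg (coeff a₀ a j)]
  rw [← sq_abs] at hsM hfour ⊢
  have hm := abs_nonneg (coeff a₀ a o)
  generalize |coeff a₀ a o| = m at hsM hfour hm
  rcases le_or_gt δ (1 / 32) with hδ | hδ
  swap
  · nlinarith
  set D := muPExp n (1 / 2) (fun x => |signForm a₀ a x ^ 2 - 1|) with hD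
  have hD0 : 0 ≤ D := muPExp_nonneg (by norm_num) (by norm_num) fun x => abs_nonneg _
  have hD2 : D ^ 2 ≤ 9 * δ := by
    have hcs := muPExp_mul_sq_le (n := n) (p := 1 / 2) (by norm_num) (by norm_num)
      (fun x => |(|signForm a₀ a x| - 1)|) (fun x => |signForm a₀ a x| + 1)
    have e1 : (fun x => |(|signForm a₀ a x| - 1)| * (|signForm a₀ a x| + 1)) =
        fun x => |signForm a₀ a x ^ 2 - 1| := by
      funext x
      have : signForm a₀ a x ^ 2 - 1 = (|signForm a₀ a x| - 1) * (|signForm a₀ a x| + 1) := by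
        rw [← sq_abs]; ring
      rw [this, abs_mul, abs_of_nonneg (a := |signForm a₀ a x| + 1) (by positivity)]
    rw [e1] at hcs
    simp only [sq_abs] at hcs
    have e2 : muPExp n (1 / 2) (fun x => (|signForm a₀ a x| + 1) ^ 2) ≤ 9 := by
      have := muPExp_mono (n := n) (p := 1 / 2) (by norm_num) (by norm_num)
        (g := fun x => (|signForm a₀ a x| + 1) ^ 2)
        (h := fun x => 2 * signForm a₀ a x ^ 2 + 2) (fun x => by
          rw [← sq_abs (signForm a₀ a x)]
          nlinarith [sq_nonneg (|signForm a₀ a x| - 1)])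
      rw [muPExp_add, muPExp_const_mul, muPExp_const, muPExp_signForm_sq] at this
      linarith
    refine hcs.trans ?_
    have := mul_le_mul h e2 (muPExp_nonneg (by norm_num) (by norm_num) fun x => sq_nonneg _) hδ0
    linarith
  have hs1 : |s - 1| ≤ D := by
    have hmean : s - 1 = muPExp n (1 / 2) (fun x => signForm a₀ a x ^ 2 - 1) := by
      rw [muPExp_sub, muPExp_const, muPExp_signForm_sq]
    rw [hmean, hD]
    have hup := muPExp_mono (n := n) (p := 1 / 2) (by norm_num) (by norm_num)
      (fun x => le_abs_self (signForm a₀ a x ^ 2 - 1))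
    have hlo := muPExp_mono (n := n) (p := 1 / 2) (by norm_num) (by norm_num)
      (fun x => neg_abs_le (signForm a₀ a x ^ 2 - 1))
    simp only [← neg_one_mul |_|] at hlo
    rw [muPExp_const_mul] at hlo
    exact abs_le.2 ⟨by linarith, hup⟩
  have hsD : (s - 1) ^ 2 ≤ D ^ 2 := sq_le_sq.2 (by rwa [abs_of_nonneg hD0])
  have hQ : muPExp n (1 / 2) (fun x => |signQuad a₀ a x|) ≤ 2 * D := by
    have := muPExp_mono (n := n) (p := 1 / 2) (by norm_num) (by norm_num)
      (g := fun x => |signQuad a₀ a x|) (h := fun x => |signForm a₀ a x ^ 2 - 1| + |s - 1|)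
      (fun x => by
        have : signQuad a₀ a x = (signForm a₀ a x ^ 2 - 1) - (s - 1) := by
          rw [signQuad, ← hs]; ring
        rw [this]
        exact abs_sub _ _)
    rw [muPExp_add, muPExp_const] at this
    linarith
  have hV := muPExp_signQuad_sq_le_abs a₀ a
  have hQ0 : 0 ≤ muPExp n (1 / 2) (fun x => |signQuad a₀ a x|) :=
    muPExp_nonneg (by norm_num) (by norm_num) fun x => abs_nonneg _
  have hQ2 : muPExp n (1 / 2) (fun x => |signQuad a₀ a x|) ^ 2 ≤ (2 * D) ^ 2 := by gcongr
  rw [muPExp_signQuad_sq, ← hs] at hV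
  have hs3 : s ≤ 33 / 16 := by linarith
  have hs2 : 2 / 5 ≤ s := by
    by_contra! hlt
    nlinarith
  have hgap : s - m ^ 2 ≤ 30000 * δ := by
    have e1 : 2 * (s * (s - m ^ 2)) ≤ 648 * 4 * (9 * δ) := by nlinarith
    nlinarith
  have e1 : (m - 1) ^ 2 ≤ (m ^ 2 - 1) ^ 2 := by
    have : (m ^ 2 - 1) ^ 2 = (m - 1) ^ 2 * (m + 1) ^ 2 := by ring
    rw [this]
    exact le_mul_of_one_le_right (sq_nonneg _) (by nlinarith)
  have e2 : (m ^ 2 - 1) ^ 2 ≤ 2 * (s - m ^ 2) ^ 2 + 2 * (s - 1) ^ 2 := by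
    nlinarith [sq_nonneg ((m ^ 2 - s) - (s - 1))]
  have e3 : (s - m ^ 2) ^ 2 ≤ 33 / 16 * (s - m ^ 2) := by nlinarith
  nlinarith

/-- A nearest element of `{-1, 0, 1}`. -/
noncomputable def roundSign (c : ℝ) : ℝ := if 1 / 2 ≤ c then 1 else if c ≤ -(1 / 2) then -1 else 0

lemma roundSign_zero : roundSign 0 = 0 := by norm_num [roundSign]

lemma roundSign_cases (c : ℝ) : roundSign c = 0 ∨ roundSign c = 1 ∨ roundSign c = -1 := by
  unfold roundSign; split_ifs <;> simp

lemma sub_roundSign_sq_le_sq (c : ℝ) : (c - roundSign c) ^ 2 ≤ c ^ 2 := by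
  unfold roundSign; split_ifs <;> nlinarith

lemma sub_roundSign_sq_le_abs (c : ℝ) : (c - roundSign c) ^ 2 ≤ (|c| - 1) ^ 2 := by
  unfold roundSign
  split_ifs with h1 h2
  · rw [abs_of_nonneg (by linarith)]
  · rw [abs_of_nonpos (by linarith)]; nlinarith
  · have : |c| ≤ 1 / 2 := abs_le.2 ⟨by linarith, by linarith⟩
    rw [sub_zero, ← sq_abs c]
    nlinarith

lemma quarter_le_sq_of_roundSign_ne_zero {c : ℝ} (h : roundSign c ≠ 0) : 1 / 4 ≤ c ^ 2 := by
  unfold roundSign at h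
  split_ifs at h with h1 h2
  · nlinarith
  · nlinarith
  · exact absurd rfl h

/-- If an affine form is close to `±1` under the uniform measure then its nonconstant
coefficients are close to `{-1, 0, 1}`, at most one of them being large. -/
lemma signForm_rounding {n : ℕ} (a₀ : ℝ) (a : Fin n → ℝ) {δ : ℝ}
    (h : muPExp n (1 / 2) (fun x => (|signForm a₀ a x| - 1) ^ 2) ≤ δ) :
    ∑ i, (a i - roundSign (a i)) ^ 2 ≤ 160000 * δ ∧
      ∀ i j, i ≠ j → roundSign (a i) ≠ 0 → roundSign (a j) ≠ 0 → 1 / 4 ≤ 160000 * δ := by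
  obtain ⟨o, ho⟩ := exists_dominant_coeff a₀ a h
  have hsplit : ∑ o' ∈ Finset.univ.erase o, coeff a₀ a o' ^ 2 =
      energy a₀ a - coeff a₀ a o ^ 2 := by
    rw [energy, ← sum_coeff_pow, ← Finset.add_sum_erase _ _ (Finset.mem_univ o)]
    ring
  constructor
  · refine le_trans ?_ ho
    rw [← hsplit]
    calc ∑ i, (a i - roundSign (a i)) ^ 2
        ≤ ∑ o', (if o' = o then (|coeff a₀ a o'| - 1) ^ 2 else coeff a₀ a o' ^ 2) := by
          rw [Fintype.sum_option]
          have h0 : 0 ≤ (if none = o then (|coeff a₀ a none| - 1) ^ 2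
              else coeff a₀ a none ^ 2) := by split_ifs <;> positivity
          refine le_add_of_nonneg_of_le h0 (Finset.sum_le_sum fun i _ => ?_)
          split_ifs
          · exact sub_roundSign_sq_le_abs (a i)
          · exact sub_roundSign_sq_le_sq (a i)
      _ = _ := by
          rw [← Finset.add_sum_erase _ _ (Finset.mem_univ o), if_pos rfl, add_comm]
          congr 1
          exact Finset.sum_congr rfl fun o' ho' => if_neg (Finset.ne_of_mem_erase ho')
  · have hone : ∀ i, some i ≠ o → roundSign (a i) ≠ 0 → 1 / 4 ≤ 160000 * δ := by
      intro i hio hi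
      have h1 := quarter_le_sq_of_roundSign_ne_zero hi
      have h2 : a i ^ 2 ≤ ∑ o' ∈ Finset.univ.erase o, coeff a₀ a o' ^ 2 :=
        Finset.single_le_sum (f := fun o' => coeff a₀ a o' ^ 2) (fun _ _ => sq_nonneg _)
          (Finset.mem_erase.2 ⟨hio, Finset.mem_univ (some i)⟩)
      nlinarith [sq_nonneg (|coeff a₀ a o| - 1)]
    intro i j hij hi hj
    by_cases hio : some i = o
    · refine hone j (fun hjo => hij ?_) hj
      exact Option.some_injective _ (hio.trans hjo.symm)
    · exact hone i hio hi

open Classical in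
/-- The indicator of the points with at least two nonzero coordinates in `S`. -/
noncomputable def twoHit {n : ℕ} (S : Finset (Fin n)) (x : Fin n → Bool) : ℝ :=
  if ∃ i ∈ S, ∃ j ∈ S, i ≠ j ∧ x i = true ∧ x j = true then 1 else 0

lemma twoHit_nonneg {n : ℕ} (S : Finset (Fin n)) (x : Fin n → Bool) : 0 ≤ twoHit S x := by
  unfold twoHit; split_ifs <;> norm_num

lemma muPExp_coord {n : ℕ} (p : ℝ) (i : Fin n) :
    muPExp n p (fun x => if x i then 1 else 0) = p := by
  have e (j : Fin n) : p * (if j = i then (if true then 1 else 0) else 1) +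
      (1 - p) * (if j = i then (if false then 1 else 0) else 1) = if j = i then p else 1 := by
    split_ifs <;> simp_all
  have h := (muPExp_prod n p (fun j b => if j = i then (if b then 1 else 0) else 1)).trans
    (Finset.prod_congr rfl fun j _ => e j)
  simpa using h

/-- The sampled form of the structure theorem: the coefficients of an affine function close to
`{0, 1}` under `μ_p`. -/
lemma affine_rounding {n : ℕ} {p : ℝ} (hp0 : 0 < p) (hp : p ≤ 1 / 2) (c₀ : ℝ) (c : Fin n → ℝ)
    {δ : ℝ}
    (h : muPExp n p
      (fun x => (|2 * (c₀ + ∑ i, (if x i then c i else 0)) - 1| - 1) ^ 2) ≤ δ) :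
    2 * p * ∑ i, (c i - roundSign (c i)) ^ 2 ≤ 160000 * δ ∧
      muPExp n (2 * p) (twoHit (Finset.univ.filter fun i => roundSign (c i) ≠ 0)) ≤
        640000 * δ := by
  let H : (Fin n → Bool) → ℝ :=
    fun x => (|2 * (c₀ + ∑ i, (if x i then c i else 0)) - 1| - 1) ^ 2
  let Δ : (Fin n → Bool) → ℝ := fun z => muPExp n (1 / 2) (fun y => H (fun i => z i && y i))
  have hΔ : muPExp n (2 * p) Δ ≤ δ := by
    rw [muPExp_and n (2 * p) (1 / 2) H, show 2 * p * (1 / 2) = p by ring]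
    exact h
  have key (z : Fin n → Bool) := signForm_rounding
    (2 * c₀ - 1 + ∑ i, (if z i then c i else 0)) (fun i => if z i then c i else 0) (δ := Δ z) (by
      refine le_of_eq ?_
      simp only [Δ, H]
      congr 1
      funext y
      congr 3
      have : 2 * ∑ i, (if (z i && y i) then c i else 0) = ∑ i, (if z i then c i else 0) +
          ∑ i, (if y i then (if z i then c i else 0) else -(if z i then c i else 0)) := by
        rw [Finset.mul_sum, ← Finset.sum_add_distrib]
        refine Finset.sum_congr rfl fun i _ => ?_
        cases z i <;> cases y i <;> simp
        ring
      rw [signForm, mul_add, this]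
      ring)
  constructor
  · have h1 := muPExp_mono (p := 2 * p) (by linarith) (by linarith) fun z => (key z).1
    rw [muPExp_const_mul] at h1
    have h2 : muPExp n (2 * p) (fun z => ∑ i, ((if z i then c i else 0) -
        roundSign (if z i then c i else 0)) ^ 2) = 2 * p * ∑ i, (c i - roundSign (c i)) ^ 2 := by
      rw [muPExp_sum, Finset.mul_sum]
      refine Finset.sum_congr rfl fun i _ => ?_
      have hcoord := muPExp_const_mul n (2 * p) ((c i - roundSign (c i)) ^ 2)
        (fun z => if z i then 1 else 0)
      rw [muPExp_coord, mul_comm _ (2 * p)] at hcoord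
      rw [← hcoord]
      congr 1
      funext z
      cases z i <;> simp [roundSign_zero]
    rw [h2] at h1
    linarith
  · have h1 := muPExp_mono (p := 2 * p) (by linarith) (by linarith)
      (g := twoHit (Finset.univ.filter fun i => roundSign (c i) ≠ 0))
      (h := fun z => 640000 * Δ z) (fun z => by
        unfold twoHit
        split_ifs with hz
        · obtain ⟨i, hi, j, hj, hij, hzi, hzj⟩ := hz
          have := (key z).2 i j hij (by simpa [hzi] using hi) (by simpa [hzj] using hj)
          linarith
        · have : 0 ≤ Δ z := muPExp_nonneg (by norm_num) (by norm_num) fun y => sq_nonneg _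
          positivity)
    rw [muPExp_const_mul] at h1
    linarith

/-- The probability of vanishing on `S`. -/
lemma muPExp_vanish {n : ℕ} (p : ℝ) (S : Finset (Fin n)) :
    muPExp n p (fun x => ∏ i ∈ S, (if x i then 0 else 1)) = (1 - p) ^ S.card := by
  have e (j : Fin n) : p * (if j ∈ S then (if true then 0 else 1) else 1) +
      (1 - p) * (if j ∈ S then (if false then 0 else 1) else 1) =
        if j ∈ S then 1 - p else 1 := by
    split_ifs <;> simp_all
  have h := (muPExp_prod n p (fun j b => if j ∈ S then (if b then 0 else 1) else 1)).trans
    (Finset.prod_congr rfl fun j _ => e j)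
  simp only [Finset.prod_ite_mem, Finset.univ_inter, Finset.prod_const] at h
  exact h

lemma vanish_eq {n : ℕ} (S : Finset (Fin n)) (x : Fin n → Bool) :
    ∏ i ∈ S, (if x i then (0 : ℝ) else 1) = if ∃ i ∈ S, x i = true then 0 else 1 := by
  split_ifs with h
  · obtain ⟨i, hi, hx⟩ := h
    exact Finset.prod_eq_zero hi (by simp [hx])
  · push Not at h
    exact Finset.prod_eq_one fun i hi => by simp [h i hi]

lemma sq_le_muPExp_twoHit {n : ℕ} {q : ℝ} (h0 : 0 ≤ q) (h1 : q ≤ 1) (S : Finset (Fin n)) {k : ℕ}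
    (hk : 2 * k ≤ S.card) : (1 - (1 - q) ^ k) ^ 2 ≤ muPExp n q (twoHit S) := by
  obtain ⟨T, hTS, hT⟩ := Finset.exists_subset_card_eq hk
  obtain ⟨A, hAT, hA⟩ := Finset.exists_subset_card_eq (s := T) (n := k) (by omega)
  have hB : (T \ A).card = k := by rw [Finset.card_sdiff_of_subset hAT]; omega
  have hcalc : muPExp n q (fun x => 1 - ∏ i ∈ A, (if x i then 0 else 1) -
      ∏ i ∈ T \ A, (if x i then 0 else 1) + ∏ i ∈ T, (if x i then 0 else 1)) =
      (1 - (1 - q) ^ k) ^ 2 := by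
    rw [muPExp_add, muPExp_sub, muPExp_sub, muPExp_const, muPExp_vanish, muPExp_vanish,
      muPExp_vanish, hA, hB, hT]
    ring
  rw [← hcalc]
  refine muPExp_mono h0 h1 fun x => ?_
  rw [← Finset.prod_sdiff hAT]
  simp only [vanish_eq]
  split_ifs with h2 h3 h4
  · obtain ⟨i, hi, hxi⟩ := h2
    obtain ⟨j, hj, hxj⟩ := h3
    have hj' := Finset.mem_sdiff.1 hj
    have : twoHit S x = 1 := if_pos
      ⟨i, hTS (hAT hi), j, hTS hj'.1, fun hij => hj'.2 (hij ▸ hi), hxi, hxj⟩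
    rw [this]; norm_num
  all_goals
    have := twoHit_nonneg S x
    norm_num
    try linarith

lemma muPExp_twoHit_le_double {n : ℕ} {p : ℝ} (hp0 : 0 ≤ p) (hp : p ≤ 1 / 2)
    (S : Finset (Fin n)) : muPExp n p (twoHit S) ≤ muPExp n (2 * p) (twoHit S) := by
  have h := muPExp_and n (2 * p) (1 / 2) (twoHit S)
  rw [show 2 * p * (1 / 2) = p by ring] at h
  rw [← h]
  refine muPExp_mono (by linarith) (by linarith) fun z => ?_
  rw [← muPExp_const n (1 / 2) (twoHit S z)]
  refine muPExp_mono (by norm_num) (by norm_num) fun y => ?_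
  by_cases hz : ∃ i ∈ S, ∃ j ∈ S, i ≠ j ∧ (z i && y i) = true ∧ (z j && y j) = true
  · have h1 : twoHit S z = 1 := by
      obtain ⟨i, hi, j, hj, hij, hzi, hzj⟩ := hz
      simp only [Bool.and_eq_true] at hzi hzj
      exact if_pos ⟨i, hi, j, hj, hij, hzi.1, hzj.1⟩
    rw [h1]
    unfold twoHit
    split_ifs <;> norm_num
  · have h1 : twoHit S (fun i => z i && y i) = 0 := if_neg hz
    rw [h1]
    exact twoHit_nonneg S z

/-- A Boolean function close to a signed sum of few coordinates is close to the maximum of those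
with a positive sign. -/
lemma muPExp_sub_cubeMax_sq_le {n : ℕ} {p : ℝ} (h0 : 0 ≤ p) (h1 : p ≤ 1)
    {f : (Fin n → Bool) → ℝ} (hf : ∀ x, f x = 0 ∨ f x = 1) {t : Fin n → ℝ}
    (ht : ∀ i, t i = 0 ∨ t i = 1 ∨ t i = -1) :
    muPExp n p (fun x => (f x - cubeMax (Finset.univ.filter fun i => t i = 1) x) ^ 2) ≤
      muPExp n p (fun x => (f x - ∑ i, (if x i then t i else 0)) ^ 2) +
        muPExp n p (twoHit (Finset.univ.filter fun i => t i ≠ 0)) := by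
  rw [← muPExp_add]
  refine muPExp_mono h0 h1 fun x => ?_
  by_cases h2 : ∃ i ∈ Finset.univ.filter (fun i => t i ≠ 0),
      ∃ j ∈ Finset.univ.filter (fun i => t i ≠ 0), i ≠ j ∧ x i = true ∧ x j = true
  · have e : twoHit (Finset.univ.filter fun i => t i ≠ 0) x = 1 := if_pos h2
    rw [e]
    have : (f x - cubeMax (Finset.univ.filter fun i => t i = 1) x) ^ 2 ≤ 1 := by
      unfold cubeMax
      rcases hf x with h | h <;> rw [h] <;> split_ifs <;> norm_num
    nlinarith [sq_nonneg (f x - ∑ i, (if x i then t i else 0))]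
  · refine le_add_of_le_of_nonneg ?_ (twoHit_nonneg _ _)
    by_cases h3 : ∃ i, t i ≠ 0 ∧ x i = true
    · obtain ⟨i, hi, hxi⟩ := h3
      have huniq : ∀ j, x j = true → t j ≠ 0 → j = i := by
        intro j hxj hj
        by_contra hne
        exact h2 ⟨i, by simpa using hi, j, by simpa using hj, Ne.symm hne, hxi, hxj⟩
      have hsum : ∑ j, (if x j then t j else 0) = t i := by
        rw [Finset.sum_eq_single i, if_pos hxi]
        · intro j _ hji
          by_cases hxj : x j = true
          · rw [if_pos hxj]
            by_contra hj
            exact hji (huniq j hxj hj)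
          · rw [if_neg hxj]
        · simp
      rw [hsum]
      rcases ht i with h | h | h
      · exact absurd h hi
      · have : cubeMax (Finset.univ.filter fun i => t i = 1) x = 1 :=
          if_pos ⟨i, by simpa using h, hxi⟩
        rw [this, h]
      · have : cubeMax (Finset.univ.filter fun i => t i = 1) x = 0 := by
          refine if_neg ?_
          rintro ⟨j, hj, hxj⟩
          have hj1 : t j = 1 := by simpa using hj
          have hji := huniq j hxj (by rw [hj1]; norm_num)
          rw [hji, h] at hj1
          norm_num at hj1
        rw [this, h]
        rcases hf x with h | h <;> rw [h] <;> norm_num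
    · push Not at h3
      have hsum : ∑ j, (if x j then t j else 0) = 0 := by
        refine Finset.sum_eq_zero fun j _ => ?_
        by_cases hj : t j = 0
        · simp [hj]
        · simp [h3 j hj]
      have : cubeMax (Finset.univ.filter fun i => t i = 1) x = 0 := by
        refine if_neg ?_
        rintro ⟨j, hj, hxj⟩
        have hj1 : t j = 1 := by simpa using hj
        exact h3 j (by rw [hj1]; norm_num) hxj
      rw [hsum, this]

/-- A large set is hit twice with large probability. -/
lemma card_le_of_muPExp_twoHit_le {n : ℕ} {p y : ℝ} (hp0 : 0 < p) (hp : p ≤ 1 / 2) (hy0 : 0 ≤ y)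
    (hy : y ≤ 1 / 10 ^ 4) {S : Finset (Fin n)} (hS : 2 ≤ S.card)
    (h : muPExp n (2 * p) (twoHit S) ≤ (1600 * y) ^ 2) : p * S.card ≤ 3000 * y := by
  set k := S.card / 2 with hk
  have hk3 : (S.card : ℝ) ≤ 3 * k := by exact_mod_cast (by omega : S.card ≤ 3 * k)
  have h1 := (sq_le_muPExp_twoHit (q := 2 * p) (by linarith) (by linarith) S
    (k := k) (by omega)).trans h
  have h2 : 1 - (1 - 2 * p) ^ k ≤ 1600 * y := (abs_le_of_sq_le_sq' h1 (by positivity)).2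
  have h3 : (1 - 2 * p) ^ k * (1 + k * (2 * p)) ≤ 1 := by
    have hb := one_add_mul_le_pow (a := 2 * p) (by linarith) k
    have h0 : 0 ≤ (1 - 2 * p) ^ k := pow_nonneg (by linarith) k
    calc (1 - 2 * p) ^ k * (1 + k * (2 * p)) ≤ (1 - 2 * p) ^ k * (1 + 2 * p) ^ k := by gcongr
      _ = ((1 - 2 * p) * (1 + 2 * p)) ^ k := (mul_pow _ _ _).symm
      _ ≤ 1 := pow_le_one₀ (by nlinarith) (by nlinarith)
  set w : ℝ := k * (2 * p) with hw
  have hw0 : 0 ≤ w := by positivity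
  have h4 : w ≤ 2000 * y := by
    have : (1 - 1600 * y) * (1 + w) ≤ 1 :=
      (mul_le_mul_of_nonneg_right (by linarith) (by linarith)).trans h3
    nlinarith
  have : p * S.card ≤ p * (3 * k) := by gcongr
  nlinarith

/-- The theorem for `p ≤ 1/2`. -/
lemma exists_close_cubeMax {n : ℕ} {p : ℝ} {f : (Fin n → Bool) → ℝ} {c₀ : ℝ} {c : Fin n → ℝ}
    {ε : ℝ} (hp0 : 0 < p) (hp : p ≤ 1 / 2) (hf : ∀ x, f x = 0 ∨ f x = 1)
    (h : muPExp n p (fun x => (f x - (c₀ + ∑ i, (if x i then c i else 0))) ^ 2) ≤ ε) :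
    ∃ S : Finset (Fin n), (S.card : ℝ) ≤ max 1 (10 ^ 8 * √ε / p) ∧
      (muPExp n p (fun x => (f x - cubeMax S x) ^ 2) ≤ 10 ^ 8 * ε ∨
        muPExp n p (fun x => ((1 - f x) - cubeMax S x) ^ 2) ≤ 10 ^ 8 * ε) := by
  have hp1 : p ≤ 1 := by linarith
  have hε0 : 0 ≤ ε := (muPExp_nonneg hp0.le hp1 fun x => sq_nonneg _).trans h
  rcases le_or_gt ε (1 / 10 ^ 8) with hε | hε
  swap
  · refine ⟨∅, by simp, Or.inl ?_⟩
    have h1 : muPExp n p (fun x => (f x - cubeMax ∅ x) ^ 2) ≤ muPExp n p (fun _ => 1) :=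
      muPExp_mono hp0.le hp1 fun x => by
        rcases hf x with h | h <;> simp [cubeMax, h]
    rw [muPExp_const] at h1
    linarith
  set t : Fin n → ℝ := fun i => roundSign (c i) with ht
  set S : Finset (Fin n) := Finset.univ.filter fun i => t i ≠ 0 with hS
  obtain ⟨hround, htwo⟩ := affine_rounding hp0 hp c₀ c (δ := 4 * ε) (by
    refine le_trans (muPExp_mono hp0.le hp1 fun x => ?_)
      ((muPExp_const_mul n p 4 _).trans_le (mul_le_mul_of_nonneg_left h (by norm_num)))
    generalize c₀ + ∑ i, (if x i then c i else 0) = l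
    rcases hf x with h | h <;> rw [h] <;> rcases abs_cases (2 * l - 1) with ⟨e, _⟩ | ⟨e, _⟩ <;>
      rw [e] <;> nlinarith)
  have hy0 := Real.sqrt_nonneg ε
  have hy2 : √ε ^ 2 = ε := Real.sq_sqrt hε0
  have hy : √ε ≤ 1 / 10 ^ 4 := by
    refine Real.sqrt_le_iff.2 ⟨by norm_num, hε.trans (by norm_num)⟩
  have hcard : S.card ≤ 1 ∨ p * S.card ≤ 3000 * √ε := by
    rcases le_or_gt S.card 1 with h1 | h1
    · exact Or.inl h1
    · refine Or.inr (card_le_of_muPExp_twoHit_le hp0 hp hy0 hy h1 (htwo.trans ?_))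
      rw [mul_pow, hy2]
      linarith
  have hcard' : (S.card : ℝ) ≤ max 1 (10 ^ 8 * √ε / p) := by
    rcases hcard with h1 | h1
    · exact le_max_of_le_left (by exact_mod_cast h1)
    · refine le_max_of_le_right ((le_div_iff₀ hp0).2 ?_)
      linarith
  have hvanish : 1 / 2 ≤ (1 - p) ^ S.card := by
    rcases hcard with h1 | h1
    · calc 1 / 2 ≤ (1 - p) ^ 1 := by linarith
        _ ≤ (1 - p) ^ S.card := pow_le_pow_of_le_one (by linarith) (by linarith) h1
    · have := one_add_mul_le_pow (a := -p) (by linarith) S.card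
      rw [← sub_eq_add_neg] at this
      linarith
  set d : Fin n → ℝ := fun i => c i - t i with hd
  set b₀ : ℝ := c₀ + p * ∑ i, d i with hb₀
  have hclose : muPExp n p (fun x => (f x - (b₀ + ∑ i, (if x i then t i else 0))) ^ 2) ≤
      800000 * ε := by
    have hle := muPExp_mono hp0.le hp1
      (g := fun x => (f x - (b₀ + ∑ i, (if x i then t i else 0))) ^ 2)
      (h := fun x => 2 * (f x - (c₀ + ∑ i, (if x i then c i else 0))) ^ 2 +
        2 * (∑ i, d i * ((if x i then 1 else 0) - p)) ^ 2) (fun x => by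
          have e : ∑ i, d i * ((if x i then 1 else 0) - p) = ∑ i, (if x i then c i else 0) -
              ∑ i, (if x i then t i else 0) - p * ∑ i, d i := by
            rw [Finset.mul_sum, ← Finset.sum_sub_distrib, ← Finset.sum_sub_distrib]
            refine Finset.sum_congr rfl fun i _ => ?_
            simp only [hd]
            split_ifs <;> ring
          simp only [e, hb₀]
          generalize ∑ i, (if x i then c i else 0) = A
          generalize ∑ i, (if x i then t i else 0) = B
          generalize p * ∑ i, d i = D
          nlinarith [sq_nonneg ((f x - (c₀ + A)) - (A - B - D))])
    rw [muPExp_add, muPExp_const_mul, muPExp_const_mul, muPExp_centered_sq] at hle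
    have hd0 : 0 ≤ p * (p * ∑ i, d i ^ 2) := by positivity
    have hround' : 2 * p * ∑ i, d i ^ 2 ≤ 160000 * (4 * ε) := hround
    nlinarith
  have hb : ∃ r : ℝ, (r = 0 ∨ r = 1) ∧ (r - b₀) ^ 2 ≤ 1600000 * ε := by
    have hr : ∃ r : ℝ, (r = 0 ∨ r = 1) ∧ (r - b₀) ^ 2 ≤ b₀ ^ 2 ∧ (r - b₀) ^ 2 ≤ (1 - b₀) ^ 2 := by
      rcases le_total b₀ (1 / 2) with h1 | h1
      · exact ⟨0, Or.inl rfl, by nlinarith, by nlinarith⟩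
      · exact ⟨1, Or.inr rfl, by nlinarith, by nlinarith⟩
    obtain ⟨r, hr, hr0, hr1⟩ := hr
    refine ⟨r, hr, ?_⟩
    have hle := muPExp_mono hp0.le hp1
      (g := fun x => (r - b₀) ^ 2 * ∏ i ∈ S, (if x i then 0 else 1))
      (h := fun x => (f x - (b₀ + ∑ i, (if x i then t i else 0))) ^ 2) (fun x => by
        simp only [vanish_eq]
        split_ifs with hx
        · rw [mul_zero]; positivity
        · have hsum : ∑ i, (if x i then t i else 0) = 0 := by
            refine Finset.sum_eq_zero fun i _ => ?_
            by_cases hi : t i = 0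
            · simp [hi]
            · exact if_neg fun hxi => hx ⟨i, by simpa [hS] using hi, hxi⟩
          rw [hsum]
          rcases hf x with h | h <;> rw [h] <;> linarith)
    rw [muPExp_const_mul, muPExp_vanish] at hle
    nlinarith [sq_nonneg (r - b₀)]
  have htwo' : muPExp n p (twoHit S) ≤ 2560000 * ε :=
    (muPExp_twoHit_le_double hp0.le hp S).trans (htwo.trans (by linarith))
  obtain ⟨r, hr, hrb⟩ := hb
  have hfinal : muPExp n p (fun x => (f x - (r + ∑ i, (if x i then t i else 0))) ^ 2) ≤
      4800000 * ε := by
    have hle := muPExp_mono hp0.le hp1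
      (g := fun x => (f x - (r + ∑ i, (if x i then t i else 0))) ^ 2)
      (h := fun x => 2 * (f x - (b₀ + ∑ i, (if x i then t i else 0))) ^ 2 +
        2 * (r - b₀) ^ 2) (fun x => by
          generalize ∑ i, (if x i then t i else 0) = B
          nlinarith [sq_nonneg ((f x - (b₀ + B)) + (r - b₀))])
    rw [muPExp_add, muPExp_const_mul, muPExp_const] at hle
    linarith
  have hcases : ∀ i, t i = 0 ∨ t i = 1 ∨ t i = -1 := fun i => roundSign_cases (c i)
  have hsub (v : ℝ) (hv : v ≠ 0) :
      ((Finset.univ.filter fun i => t i = v).card : ℝ) ≤ max 1 (10 ^ 8 * √ε / p) := by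
    refine le_trans ?_ hcard'
    exact_mod_cast Finset.card_le_card fun i hi => by
      have : t i = v := by simpa using hi
      simp [hS, this, hv]
  rcases hr with rfl | rfl
  · refine ⟨_, hsub 1 one_ne_zero, Or.inl ?_⟩
    refine (muPExp_sub_cubeMax_sq_le hp0.le hp1 hf hcases).trans ?_
    simp only [zero_add] at hfinal
    linarith
  · refine ⟨_, hsub (-1) (by norm_num), Or.inr ?_⟩
    have hle := muPExp_sub_cubeMax_sq_le hp0.le hp1 (f := fun x => 1 - f x) (t := fun i => -t i)
      (fun x => by rcases hf x with h | h <;> simp [h])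
      (fun i => by rcases hcases i with h | h | h <;> simp [h])
    simp only [ne_eq, neg_eq_zero] at hle
    simp only [neg_eq_iff_eq_neg] at hle
    refine hle.trans ?_
    have e : (fun x => (1 - f x - ∑ i, (if x i = true then -t i else 0)) ^ 2) =
        fun x => (f x - (1 + ∑ i, (if x i then t i else 0))) ^ 2 := by
      funext x
      have : ∑ i, (if x i = true then -t i else 0) = -∑ i, (if x i then t i else 0) := by
        rw [← Finset.sum_neg_distrib]
        exact Finset.sum_congr rfl fun i _ => by split_ifs <;> simp
      rw [this]
      ring
    rw [e]
    linarith

lemma cubeMax_not {n : ℕ} (S : Finset (Fin n)) (x : Fin n → Bool) :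
    cubeMax S (fun i => !x i) = 1 - cubeMin S x := by
  unfold cubeMax cubeMin
  by_cases h : ∀ i ∈ S, x i = true
  · rw [if_pos h, if_neg]
    · norm_num
    · rintro ⟨i, hi, hx⟩
      simp [h i hi] at hx
  · rw [if_neg h, if_pos]
    · norm_num
    · push Not at h
      simpa using h

end BiasedCube

/-- the uniform FKN theorem for the biased Boolean cube. There is an
absolute constant `C` (independent of `p` and `n`) such that if a Boolean `f` is
`ε`-close under `μ_p` to an affine function, then `f` or `1-f` is `Cε`-close under
`μ_p` to `max_{i∈S} x_i` (when `p ≤ 1/2`) or `min_{i∈S} x_i` (when `p > 1/2`), for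
some `S` with `|S| ≤ max(1, C√ε/min(p, 1-p))`. -/
theorem fkn_biased_cube :
    ∃ C > (0 : ℝ), ∀ (n : ℕ) (p : ℝ) (f : (Fin n → Bool) → ℝ)
        (c₀ : ℝ) (c : Fin n → ℝ) (ε : ℝ),
      0 < p → p < 1 →
      (∀ x, f x = 0 ∨ f x = 1) →
      muPExp n p (fun x => (f x - (c₀ + ∑ i : Fin n, (if x i then c i else 0))) ^ 2) ≤ ε →
      ∃ S : Finset (Fin n),
        (S.card : ℝ) ≤ max 1 (C * Real.sqrt ε / min p (1 - p)) ∧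
        ∃ g : (Fin n → Bool) → ℝ,
          ((p ≤ 1 / 2 ∧ g = cubeMax S) ∨ (1 / 2 < p ∧ g = cubeMin S)) ∧
          (muPExp n p (fun x => (f x - g x) ^ 2) ≤ C * ε ∨
           muPExp n p (fun x => ((1 - f x) - g x) ^ 2) ≤ C * ε) := by
  refine ⟨10 ^ 8, by norm_num, fun n p f c₀ c ε hp0 hp1 hf h => ?_⟩
  rcases le_or_gt p (1 / 2) with hp | hp
  · obtain ⟨S, hS, hclose⟩ := BiasedCube.exists_close_cubeMax hp0 hp hf h
    refine ⟨S, ?_, cubeMax S, Or.inl ⟨hp, rfl⟩, hclose⟩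
    rwa [min_eq_left (by linarith)]
  · have hflip : muPExp n (1 - p) (fun x => (f (fun i => !x i) -
        ((c₀ + ∑ i, c i) + ∑ i, (if x i then -c i else 0))) ^ 2) ≤ ε := by
      rw [← BiasedCube.muPExp_not n p] at h
      refine le_trans (le_of_eq ?_) h
      congr 1
      funext x
      rw [add_assoc, ← Finset.sum_add_distrib]
      congr 4
      funext i
      rcases hx : x i <;> simp [hx]
    obtain ⟨S, hS, hclose⟩ := BiasedCube.exists_close_cubeMax (by linarith) (by linarith)
      (fun x => hf fun i => !x i) hflip
    refine ⟨S, ?_, cubeMin S, Or.inr ⟨hp, rfl⟩, ?_⟩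
    · rwa [min_eq_right (by linarith)]
    · have hmin (x : Fin n → Bool) : cubeMax S x = 1 - cubeMin S (fun i => !x i) := by
        rw [← BiasedCube.cubeMax_not]
        simp
      simp only [hmin] at hclose
      rw [BiasedCube.muPExp_not n p (fun x => (f x - (1 - cubeMin S x)) ^ 2),
        BiasedCube.muPExp_not n p (fun x => (1 - f x - (1 - cubeMin S x)) ^ 2)] at hclose
      refine hclose.symm.imp (fun hc => ?_) (fun hc => ?_)
      · refine le_trans (le_of_eq ?_) hc
        congr 1
        funext x
        ring
      · refine le_trans (le_of_eq ?_) hc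
        congr 1
        funext x
        ring
end
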